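/- arXiv:2405.04385 — 4 statements merged into one kernel-verified Lean document; each statement's English description precedes it below -/
import Mathlib

section
/- Let α ∈ {−1/d : d ∈ ℕ, d ≥ 3} ∪ [0,∞), q ∈ [0,1] with q ≥ (2α+1)/(4(α+1)), and let (Δ(n))_{n≥1} be any shape exchangeable color-difference process with parameters (α, q) on a probability space (Ω, 𝒜, μ). Then limsup_{N→∞} [ μ(Δ₁(N) < 0) + (1/2)·μ(Δ₁(N) = 0) ] = 1/2. -/
open MeasureTheory Filter
open scoped ENat

/-- Normalisation `Z_α(n) = 2α(1 - 1/n) + 1` for shape exchangeable trees. -/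
noncomputable def Zse (α : ℝ) (n : ℕ) : ℝ := 2 * α * (1 - 1 / (n : ℝ)) + 1

/-- `p(n, x₁, x₂) = (1/2)(1 + (x₁ + α x₂)/(Z_α(n) n))`, the probability that the new vertex
attaches to a red vertex. -/
noncomputable def pse (α : ℝ) (n : ℕ) (x₁ x₂ : ℤ) : ℝ :=
  (1 / 2) * (1 + ((x₁ : ℝ) + α * (x₂ : ℝ)) / (Zse α n * (n : ℝ)))

/-- The set of allowed parameters `α ∈ {-1/d : d ∈ ℕ, d ≥ 3} ∪ [0, ∞)` for
shape exchangeable trees. -/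
def seAllowed : Set ℝ := {x : ℝ | ∃ d : ℕ, 3 ≤ d ∧ x = -1 / (d : ℝ)} ∪ Set.Ici (0 : ℝ)

/-- A shape exchangeable (s.e.) color-difference process with parameters `(α, q)` on the
measurable space `Ω`: a probability measure `μ`, a filtration `F`, and an adapted `ℤ²`-valued
process `Δ` with `Δ(1) = (1,0)`, whose increments `D(n) = Δ(n+1) - Δ(n)` are
`F(n+1)`-measurable with values in `{(1,2), (-1,0), (1,0), (-1,-2)}`, and whose conditional
probabilities given `F n` (conditional expectations of indicator functions) are as prescribed. -/
structure SEProcess (α q : ℝ) (Ω : Type) [mΩ : MeasurableSpace Ω] where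
  μ : Measure Ω
  isProb : IsProbabilityMeasure μ
  F : ℕ → MeasurableSpace Ω
  F_le : ∀ n, F n ≤ mΩ
  F_mono : Monotone F
  Δ : ℕ → Ω → ℤ × ℤ
  adapted : ∀ n, 1 ≤ n → @Measurable Ω (ℤ × ℤ) (F n) _ (Δ n)
  init : ∀ ω, Δ 1 ω = (1, 0)
  D_meas : ∀ n, 1 ≤ n → @Measurable Ω (ℤ × ℤ) (F (n + 1)) _ (fun ω => Δ (n + 1) ω - Δ n ω)
  D_range : ∀ n, 1 ≤ n → ∀ ω,
    Δ (n + 1) ω - Δ n ω ∈ ({(1, 2), (-1, 0), (1, 0), (-1, -2)} : Set (ℤ × ℤ))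
  cond_rr : ∀ n, 1 ≤ n →
    μ[Set.indicator {ω | Δ (n + 1) ω - Δ n ω = (1, 2)} (fun _ => (1 : ℝ)) | F n]
      =ᵐ[μ] fun ω => pse α n (Δ n ω).1 (Δ n ω).2 * (1 - q)
  cond_br : ∀ n, 1 ≤ n →
    μ[Set.indicator {ω | Δ (n + 1) ω - Δ n ω = (-1, 0)} (fun _ => (1 : ℝ)) | F n]
      =ᵐ[μ] fun ω => pse α n (Δ n ω).1 (Δ n ω).2 * q
  cond_rb : ∀ n, 1 ≤ n →
    μ[Set.indicator {ω | Δ (n + 1) ω - Δ n ω = (1, 0)} (fun _ => (1 : ℝ)) | F n]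
      =ᵐ[μ] fun ω => (1 - pse α n (Δ n ω).1 (Δ n ω).2) * q
  cond_bb : ∀ n, 1 ≤ n →
    μ[Set.indicator {ω | Δ (n + 1) ω - Δ n ω = (-1, -2)} (fun _ => (1 : ℝ)) | F n]
      =ᵐ[μ] fun ω => (1 - pse α n (Δ n ω).1 (Δ n ω).2) * (1 - q)

/-- `τ_high(A) = inf {n ≥ 1 : Δ₁(n) + α Δ₂(n) > A Z_α(n) √n}`, with value `∞` if no such `n`
exists. -/
noncomputable def tauHigh {α q : ℝ} {Ω : Type} [MeasurableSpace Ω]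
    (P : SEProcess α q Ω) (A : ℝ) (ω : Ω) : ℕ∞ :=
  sInf {N : ℕ∞ | ∃ n : ℕ, N = (n : ℕ∞) ∧ 1 ≤ n ∧
    A * Zse α n * Real.sqrt n < ((P.Δ n ω).1 : ℝ) + α * ((P.Δ n ω).2 : ℝ)}

/-- `τ_low(B) = inf {n > τ_high(A) : Δ₁(n) + α Δ₂(n) ≤ B Z_α(n) √n}`, with value `∞` if no such
`n` exists. -/
noncomputable def tauLow {α q : ℝ} {Ω : Type} [MeasurableSpace Ω]
    (P : SEProcess α q Ω) (A B : ℝ) (ω : Ω) : ℕ∞ :=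
  sInf {N : ℕ∞ | ∃ n : ℕ, N = (n : ℕ∞) ∧ tauHigh P A ω < (n : ℕ∞) ∧
    ((P.Δ n ω).1 : ℝ) + α * ((P.Δ n ω).2 : ℝ) ≤ B * Zse α n * Real.sqrt n}

noncomputable section

namespace SEaux

/-- The linear functional `x₁ + α x₂`. -/
def Wf (α : ℝ) (x : ℤ × ℤ) : ℝ := (x.1 : ℝ) + α * (x.2 : ℝ)

/-- The normalised drift `(x₁ + α x₂)/(Z n)`. -/
def rf (α : ℝ) (n : ℕ) (x : ℤ × ℤ) : ℝ := Wf α x / (Zse α n * (n : ℝ))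

lemma alpha_ge {α : ℝ} (hα : α ∈ seAllowed) : -1 / 3 ≤ α := by
  rcases hα with ⟨d, hd, rfl⟩ | h
  · have : (3 : ℝ) ≤ d := by exact_mod_cast hd
    rw [div_le_div_iff₀ (by norm_num) (by linarith)]
    linarith
  · have : (0 : ℝ) ≤ α := h
    linarith

lemma Zn_eq (α : ℝ) (n : ℕ) (hn : 1 ≤ n) : Zse α n * (n : ℝ) = (2 * α + 1) * n - 2 * α := by
  have : (n : ℝ) ≠ 0 := by positivity
  unfold Zse
  field_simp
  ring

lemma Zn_ge {α : ℝ} (hα : -1 / 3 ≤ α) (n : ℕ) (hn : 1 ≤ n) :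
    (n : ℝ) / 3 ≤ Zse α n * (n : ℝ) := by
  rw [Zn_eq α n hn]
  have h1 : (1 : ℝ) ≤ n := by exact_mod_cast hn
  rcases le_total 0 α with h | h
  · nlinarith
  · nlinarith

variable {α q : ℝ} {Ω : Type} [mΩ : MeasurableSpace Ω]

lemma bound_Δ (P : SEProcess α q Ω) (n : ℕ) (hn : 1 ≤ n) (ω : Ω) :
    |(P.Δ n ω).1| ≤ n ∧ |(P.Δ n ω).2| ≤ 2 * n := by
  induction n, hn using Nat.le_induction with
  | base => simp [P.init]
  | succ n hn ih =>
    have h := P.D_range n hn ω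
    simp only [Set.mem_insert_iff, Set.mem_singleton_iff, Prod.ext_iff, Prod.fst_sub,
      Prod.snd_sub] at h
    rw [abs_le, abs_le] at ih ⊢
    push_cast
    omega

lemma bound_W (P : SEProcess α q Ω) (n : ℕ) (hn : 1 ≤ n) (ω : Ω) :
    |Wf α (P.Δ n ω)| ≤ (1 + 2 * |α|) * n := by
  obtain ⟨h1, h2⟩ := bound_Δ P n hn ω
  have h1' : |((P.Δ n ω).1 : ℝ)| ≤ n := by exact_mod_cast h1
  have h2' : |((P.Δ n ω).2 : ℝ)| ≤ 2 * n := by exact_mod_cast h2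
  unfold Wf
  calc _ ≤ |((P.Δ n ω).1 : ℝ)| + |α * ((P.Δ n ω).2 : ℝ)| := abs_add_le _ _
    _ = |((P.Δ n ω).1 : ℝ)| + |α| * |((P.Δ n ω).2 : ℝ)| := by rw [abs_mul]
    _ ≤ n + |α| * (2 * n) := by gcongr
    _ = _ := by ring

lemma bound_r (hα : -1 / 3 ≤ α) (P : SEProcess α q Ω) (n : ℕ) (hn : 1 ≤ n) (ω : Ω) :
    |rf α n (P.Δ n ω)| ≤ 3 * (1 + 2 * |α|) := by
  have h1 : (1 : ℝ) ≤ n := by exact_mod_cast hn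
  have hz := Zn_ge hα n hn
  have hz0 : 0 < Zse α n * (n : ℝ) := by linarith
  unfold rf
  rw [abs_div, abs_of_pos hz0, div_le_iff₀ hz0]
  refine (bound_W P n hn ω).trans ?_
  have : 0 ≤ 1 + 2 * |α| := by positivity
  nlinarith

lemma meas_Δ (P : SEProcess α q Ω) (n : ℕ) (hn : 1 ≤ n) : Measurable (P.Δ n) :=
  (P.adapted n hn).mono (P.F_le n) le_rfl

lemma finite_range (P : SEProcess α q Ω) (n : ℕ) (hn : 1 ≤ n) : (Set.range (P.Δ n)).Finite := by
  refine Set.Finite.subset (Set.Finite.prod (Set.finite_Icc (-(n : ℤ)) n)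
    (Set.finite_Icc (-(2 * n : ℤ)) (2 * n))) ?_
  rintro _ ⟨ω, rfl⟩
  obtain ⟨h1, h2⟩ := bound_Δ P n hn ω
  exact ⟨abs_le.1 h1, abs_le.1 h2⟩

lemma bdd_f {E : Type*} [NormedAddCommGroup E] (P : SEProcess α q Ω) (n : ℕ) (hn : 1 ≤ n)
    (f : ℤ × ℤ → E) : ∃ C, ∀ ω, ‖f (P.Δ n ω)‖ ≤ C := by
  obtain ⟨C, hC⟩ := ((finite_range P n hn).image (fun x => ‖f x‖)).bddAbove
  exact ⟨C, fun ω => hC ⟨_, ⟨ω, rfl⟩, rfl⟩⟩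

lemma integrable_f {E : Type*} [NormedAddCommGroup E] [MeasurableSpace E] [BorelSpace E]
    [SecondCountableTopology E] (P : SEProcess α q Ω)
    (n : ℕ) (hn : 1 ≤ n) (f : ℤ × ℤ → E) : Integrable (fun ω => f (P.Δ n ω)) P.μ := by
  have := P.isProb
  obtain ⟨C, hC⟩ := bdd_f P n hn f
  exact Integrable.of_bound ((measurable_of_countable f).comp (meas_Δ P n hn)).aestronglyMeasurable
    C (Filter.Eventually.of_forall hC)

lemma pull_out (P : SEProcess α q Ω) (n : ℕ) (hn : 1 ≤ n) (d : ℤ × ℤ) (pr : ℤ × ℤ → ℝ)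
    (h : P.μ[Set.indicator {ω | P.Δ (n + 1) ω - P.Δ n ω = d} (fun _ => (1 : ℝ)) | P.F n]
      =ᵐ[P.μ] fun ω => pr (P.Δ n ω)) (f : ℤ × ℤ → ℝ) :
    Integrable (fun ω => f (P.Δ n ω) *
      Set.indicator {ω | P.Δ (n + 1) ω - P.Δ n ω = d} (fun _ => (1 : ℝ)) ω) P.μ ∧
    ∫ ω, f (P.Δ n ω) * Set.indicator {ω | P.Δ (n + 1) ω - P.Δ n ω = d} (fun _ => (1 : ℝ)) ω ∂P.μ
      = ∫ ω, f (P.Δ n ω) * pr (P.Δ n ω) ∂P.μ := by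
  have := P.isProb
  set I : Ω → ℝ := Set.indicator {ω | P.Δ (n + 1) ω - P.Δ n ω = d} (fun _ => (1 : ℝ)) with hI
  have hms : MeasurableSet {ω | P.Δ (n + 1) ω - P.Δ n ω = d} := by
    have hm : Measurable (fun ω => P.Δ (n + 1) ω - P.Δ n ω) :=
      (P.D_meas n hn).mono (P.F_le (n + 1)) le_rfl
    exact hm (measurableSet_singleton d)
  have hIint : Integrable I P.μ := (integrable_const (1 : ℝ)).indicator hms
  obtain ⟨C, hC⟩ := bdd_f P n hn f
  have hfm : Measurable[P.F n] (fun ω => f (P.Δ n ω)) :=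
    (measurable_of_countable f).comp (P.adapted n hn)
  have hprod : Integrable (fun ω => f (P.Δ n ω) * I ω) P.μ := by
    refine Integrable.bdd_mul (c := C) hIint ?_ (Filter.Eventually.of_forall hC)
    exact ((measurable_of_countable f).comp (meas_Δ P n hn)).aestronglyMeasurable
  refine ⟨hprod, ?_⟩
  have key := condExp_mul_of_stronglyMeasurable_left (μ := P.μ) (m := P.F n)
    (f := fun ω => f (P.Δ n ω)) (g := I) hfm.stronglyMeasurable hprod hIint
  rw [← integral_condExp (P.F_le n)]
  refine integral_congr_ae ?_
  filter_upwards [key, h] with ω h1 h2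
  rw [← h2]
  exact h1

lemma integral_add4 {μ : Measure Ω} {f g h k : Ω → ℝ} (hf : Integrable f μ) (hg : Integrable g μ)
    (hh : Integrable h μ) (hk : Integrable k μ) :
    ∫ ω, (f ω + g ω + h ω + k ω) ∂μ = ∫ ω, f ω ∂μ + ∫ ω, g ω ∂μ + ∫ ω, h ω ∂μ + ∫ ω, k ω ∂μ := by
  have e1 : ∫ ω, (f ω + g ω + h ω + k ω) ∂μ = ∫ ω, (f ω + g ω + h ω) ∂μ + ∫ ω, k ω ∂μ :=
    integral_add ((hf.add hg).add hh) hk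
  have e2 : ∫ ω, (f ω + g ω + h ω) ∂μ = ∫ ω, (f ω + g ω) ∂μ + ∫ ω, h ω ∂μ :=
    integral_add (hf.add hg) hh
  rw [e1, e2, integral_add hf hg]

lemma step_real (P : SEProcess α q Ω) (n : ℕ) (hn : 1 ≤ n) (f : ℤ × ℤ → ℝ) :
    ∫ ω, f (P.Δ (n + 1) ω) ∂P.μ = ∫ ω,
      ((1 + rf α n (P.Δ n ω)) / 2 * (1 - q) * f (P.Δ n ω + (1, 2))
      + (1 + rf α n (P.Δ n ω)) / 2 * q * f (P.Δ n ω + (-1, 0))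
      + (1 - rf α n (P.Δ n ω)) / 2 * q * f (P.Δ n ω + (1, 0))
      + (1 - rf α n (P.Δ n ω)) / 2 * (1 - q) * f (P.Δ n ω + (-1, -2))) ∂P.μ := by
  have := P.isProb
  have hp : ∀ x : ℤ × ℤ, pse α n x.1 x.2 = (1 + rf α n x) / 2 := by
    intro x; unfold pse rf Wf; ring
  obtain ⟨i1, e1⟩ := pull_out P n hn (1, 2) (fun x => pse α n x.1 x.2 * (1 - q))
    (P.cond_rr n hn) (fun x => f (x + (1, 2)))
  obtain ⟨i2, e2⟩ := pull_out P n hn (-1, 0) (fun x => pse α n x.1 x.2 * q)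
    (P.cond_br n hn) (fun x => f (x + (-1, 0)))
  obtain ⟨i3, e3⟩ := pull_out P n hn (1, 0) (fun x => (1 - pse α n x.1 x.2) * q)
    (P.cond_rb n hn) (fun x => f (x + (1, 0)))
  obtain ⟨i4, e4⟩ := pull_out P n hn (-1, -2) (fun x => (1 - pse α n x.1 x.2) * (1 - q))
    (P.cond_bb n hn) (fun x => f (x + (-1, -2)))
  have hdec : ∀ ω, f (P.Δ (n + 1) ω) =
      f (P.Δ n ω + (1, 2)) * Set.indicator {ω | P.Δ (n + 1) ω - P.Δ n ω = (1, 2)}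
        (fun _ => (1 : ℝ)) ω
      + f (P.Δ n ω + (-1, 0)) * Set.indicator {ω | P.Δ (n + 1) ω - P.Δ n ω = (-1, 0)}
        (fun _ => (1 : ℝ)) ω
      + f (P.Δ n ω + (1, 0)) * Set.indicator {ω | P.Δ (n + 1) ω - P.Δ n ω = (1, 0)}
        (fun _ => (1 : ℝ)) ω
      + f (P.Δ n ω + (-1, -2)) * Set.indicator {ω | P.Δ (n + 1) ω - P.Δ n ω = (-1, -2)}
        (fun _ => (1 : ℝ)) ω := by
    intro ω
    have hs : P.Δ (n + 1) ω = P.Δ n ω + (P.Δ (n + 1) ω - P.Δ n ω) := by abel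
    have h := P.D_range n hn ω
    simp only [Set.mem_insert_iff, Set.mem_singleton_iff] at h
    simp only [Set.indicator_apply, Set.mem_ofPred_eq]
    conv_lhs => rw [hs]
    rcases h with h | h | h | h <;> simp [h]
  simp_rw [hdec]
  have j1 := integrable_f P n hn (fun x => f (x + (1, 2)) * (pse α n x.1 x.2 * (1 - q)))
  have j2 := integrable_f P n hn (fun x => f (x + (-1, 0)) * (pse α n x.1 x.2 * q))
  have j3 := integrable_f P n hn (fun x => f (x + (1, 0)) * ((1 - pse α n x.1 x.2) * q))
  have j4 := integrable_f P n hn (fun x => f (x + (-1, -2)) * ((1 - pse α n x.1 x.2) * (1 - q)))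
  rw [integral_add4 i1 i2 i3 i4, e1, e2, e3, e4, ← integral_add4 j1 j2 j3 j4]
  refine integral_congr_ae (Filter.Eventually.of_forall fun ω => ?_)
  simp only [hp]
  ring

lemma step_complex (P : SEProcess α q Ω) (n : ℕ) (hn : 1 ≤ n) (f : ℤ × ℤ → ℂ) :
    ∫ ω, f (P.Δ (n + 1) ω) ∂P.μ = ∫ ω,
      ((((1 + rf α n (P.Δ n ω)) / 2 * (1 - q) : ℝ) : ℂ) * f (P.Δ n ω + (1, 2))
      + (((1 + rf α n (P.Δ n ω)) / 2 * q : ℝ) : ℂ) * f (P.Δ n ω + (-1, 0))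
      + (((1 - rf α n (P.Δ n ω)) / 2 * q : ℝ) : ℂ) * f (P.Δ n ω + (1, 0))
      + (((1 - rf α n (P.Δ n ω)) / 2 * (1 - q) : ℝ) : ℂ) * f (P.Δ n ω + (-1, -2))) ∂P.μ := by
  have h1 := integrable_f P (n + 1) (by omega) f
  have h2 := integrable_f P n hn (fun x =>
      (((1 + rf α n x) / 2 * (1 - q) : ℝ) : ℂ) * f (x + (1, 2))
      + (((1 + rf α n x) / 2 * q : ℝ) : ℂ) * f (x + (-1, 0))
      + (((1 - rf α n x) / 2 * q : ℝ) : ℂ) * f (x + (1, 0))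
      + (((1 - rf α n x) / 2 * (1 - q) : ℝ) : ℂ) * f (x + (-1, -2)))
  apply Complex.ext
  · have := step_real P n hn (fun x => (f x).re)
    have e1 := integral_re (𝕜 := ℂ) h1
    have e2 := integral_re (𝕜 := ℂ) h2
    simp only [RCLike.re_eq_complex_re, Complex.add_re, Complex.re_ofReal_mul] at e1 e2
    rw [← e1, ← e2, this]
  · have := step_real P n hn (fun x => (f x).im)
    have e1 := integral_im (𝕜 := ℂ) h1
    have e2 := integral_im (𝕜 := ℂ) h2
    simp only [RCLike.im_eq_complex_im, Complex.add_im, Complex.im_ofReal_mul] at e1 e2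
    rw [← e1, ← e2, this]


/-- drift coefficient -/
def gam (α q : ℝ) : ℝ := 1 + 2 * α - 2 * q * (1 + α)

lemma second_moment_step (P : SEProcess α q Ω) (n : ℕ) (hn : 1 ≤ n) :
    ∫ ω, (Wf α (P.Δ (n + 1) ω)) ^ 2 ∂P.μ =
      (1 + 2 * gam α q / (Zse α n * (n : ℝ))) * ∫ ω, (Wf α (P.Δ n ω)) ^ 2 ∂P.μ
        + ((1 - q) * (1 + 2 * α) ^ 2 + q) := by
  have := P.isProb
  rw [step_real P n hn (fun x => (Wf α x) ^ 2)]
  have hi := integrable_f P n hn (fun x => (Wf α x) ^ 2)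
  rw [← integral_const_mul]
  have : ((1 - q) * (1 + 2 * α) ^ 2 + q) = ∫ ω, ((1 - q) * (1 + 2 * α) ^ 2 + q) ∂P.μ := by simp
  rw [this, ← integral_add (hi.const_mul _) (integrable_const _)]
  refine integral_congr_ae (Filter.Eventually.of_forall fun ω => ?_)
  simp only [Wf, rf, gam, Prod.fst_add, Prod.snd_add]
  push_cast
  ring

lemma second_moment (hα : -1 / 3 ≤ α) (hq0 : 0 ≤ q) (hq1 : q ≤ 1)
    (hg : 2 * gam α q ≤ 2 * α + 1) (P : SEProcess α q Ω) :
    ∃ A : ℝ, 0 < A ∧ ∀ n : ℕ, 1 ≤ n →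
      ∫ ω, (Wf α (P.Δ n ω)) ^ 2 ∂P.μ ≤ A * (Zse α n * (n : ℝ)) * Real.sqrt n := by
  have := P.isProb
  set w := (1 - q) * (1 + 2 * α) ^ 2 + q with hw
  have hw0 : 0 ≤ w := by
    have : 0 ≤ 1 - q := by linarith
    positivity
  refine ⟨6 * w + 1, by positivity, ?_⟩
  intro n hn
  induction n, hn using Nat.le_induction with
  | base =>
    simp [P.init, Wf, Zse]
    linarith
  | succ n hn ih =>
    rw [second_moment_step P n hn, ← hw]
    have hT := Zn_ge hα n hn
    have hT1 := Zn_ge hα (n + 1) (by omega)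
    have hTs : Zse α (n + 1) * ((n + 1 : ℕ) : ℝ) = Zse α n * (n : ℝ) + (2 * α + 1) := by
      rw [Zn_eq α n hn, Zn_eq α (n + 1) (by omega)]
      push_cast
      ring
    rw [hTs] at hT1 ⊢
    set T := Zse α n * (n : ℝ)
    have hn1 : (1 : ℝ) ≤ n := by exact_mod_cast hn
    have hT0 : 0 < T := by linarith
    set u := ∫ ω, (Wf α (P.Δ n ω)) ^ 2 ∂P.μ
    have hu0 : 0 ≤ u := integral_nonneg fun ω => sq_nonneg _
    push_cast at hT1 ⊢
    have hd : 2 * gam α q / T ≤ (2 * α + 1) / T := by gcongr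
    have h1 : (1 + 2 * gam α q / T) * u ≤ (1 + (2 * α + 1) / T) *
        ((6 * w + 1) * T * Real.sqrt n) := by
      have h0 : 0 ≤ (1 + (2 * α + 1) / T) := by
        have : 0 ≤ 2 * α + 1 := by linarith
        positivity
      calc _ ≤ (1 + (2 * α + 1) / T) * u := by gcongr
        _ ≤ _ := by gcongr
    have h2 : (1 + (2 * α + 1) / T) * ((6 * w + 1) * T * Real.sqrt n)
        = (6 * w + 1) * (T + (2 * α + 1)) * Real.sqrt n := by
      field_simp
    set a := Real.sqrt n
    set b := Real.sqrt ((n : ℝ) + 1)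
    have ha : a ^ 2 = n := Real.sq_sqrt (by positivity)
    have hb : b ^ 2 = n + 1 := Real.sq_sqrt (by positivity)
    have ha0 : 0 ≤ a := Real.sqrt_nonneg _
    have hb0 : 0 ≤ b := Real.sqrt_nonneg _
    have hab : a ≤ b := Real.sqrt_le_sqrt (by linarith)
    have hb1 : 1 ≤ b := by nlinarith
    have hdiff : 1 ≤ 2 * b * (b - a) := by nlinarith
    have h3 : 1 ≤ 6 * (T + (2 * α + 1)) * (b - a) := by
      have : (b ^ 2) ≤ 3 * (T + (2 * α + 1)) := by rw [hb]; linarith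
      have h4 : b ^ 2 * (b - a) ≤ 3 * (T + (2 * α + 1)) * (b - a) := by
        have : 0 ≤ b - a := by linarith
        gcongr
      nlinarith
    have h5 : w ≤ (6 * w + 1) * (T + (2 * α + 1)) * (b - a) := by
      have hX : 0 ≤ (T + (2 * α + 1)) * (b - a) := by nlinarith
      nlinarith
    have h6 : (6 * w + 1) * (T + (2 * α + 1)) * b = (6 * w + 1) * (T + (2 * α + 1)) * a
      + (6 * w + 1) * (T + (2 * α + 1)) * (b - a) := by ring
    rw [h6]
    rw [h2] at h1
    exact add_le_add h1 h5

lemma second_moment_r (hα : -1 / 3 ≤ α) (hq0 : 0 ≤ q) (hq1 : q ≤ 1)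
    (hg : 2 * gam α q ≤ 2 * α + 1) (P : SEProcess α q Ω) :
    ∃ A : ℝ, 0 < A ∧ ∀ n : ℕ, 1 ≤ n →
      ∫ ω, (rf α n (P.Δ n ω)) ^ 2 ∂P.μ ≤ A * (n : ℝ) ^ (-(1 / 2) : ℝ) := by
  obtain ⟨A, hA, h⟩ := second_moment hα hq0 hq1 hg P
  refine ⟨3 * A, by positivity, fun n hn => ?_⟩
  have hT := Zn_ge hα n hn
  have hn1 : (1 : ℝ) ≤ n := by exact_mod_cast hn
  have h1 := h n hn
  simp only [rf, div_pow]
  rw [integral_div]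
  set T := Zse α n * (n : ℝ)
  have hT0 : 0 < T := by linarith
  have hs : (n : ℝ) ^ (-(1 / 2) : ℝ) = 1 / Real.sqrt n := by
    rw [Real.rpow_neg (by positivity), Real.sqrt_eq_rpow, one_div, one_div]
  rw [hs]
  have hs0 : 0 < Real.sqrt n := Real.sqrt_pos.2 (by positivity)
  have hss : Real.sqrt n * Real.sqrt n = n := Real.mul_self_sqrt (by positivity)
  rw [div_le_iff₀ (by positivity)]
  refine h1.trans ?_
  rw [mul_one_div, div_mul_eq_mul_div, le_div_iff₀ hs0]
  have : A * T * (Real.sqrt n * Real.sqrt n) ≤ 3 * A * T ^ 2 := by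
    rw [hss]
    have : 0 < A * T := by positivity
    nlinarith
  linarith

set_option maxHeartbeats 1000000 in
lemma one_step (q r R η a₁ a₂ : ℝ) (hq0 : 0 ≤ q) (hq1 : q ≤ 1) (hR1 : 1 ≤ R) (hr : |r| ≤ R)
    (hη : R * η ≤ 1) (h1 : |a₁| ≤ η) (h2 : |a₂| ≤ η) :
    ‖((((1 - q) * Real.cos a₁ + q * Real.cos a₂ : ℝ) : ℂ)
        + Complex.I * ((r * ((1 - q) * Real.sin a₁ - q * Real.sin a₂) : ℝ) : ℂ))
      - Complex.exp (Complex.I * ((r * ((1 - q) * a₁ - q * a₂) : ℝ) : ℂ))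
        * ((Real.exp (-((1 - q) * a₁ ^ 2 + q * a₂ ^ 2) / 2) : ℝ) : ℂ)‖
      ≤ r ^ 2 * η ^ 2 + 4 * R * η ^ 3 := by
  have hη0 : 0 ≤ η := (abs_nonneg _).trans h1
  have hη1 : η ≤ 1 := by nlinarith
  have hq' : 0 ≤ 1 - q := by linarith
  have p4 : η ^ 4 ≤ η ^ 3 := pow_le_pow_of_le_one hη0 hη1 (by norm_num)
  have p5 : η ^ 5 ≤ η ^ 3 := pow_le_pow_of_le_one hη0 hη1 (by norm_num)
  have p3 : 0 ≤ η ^ 3 := by positivity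
  have cosb : ∀ a : ℝ, |a| ≤ η → |Real.cos a - (1 - a ^ 2 / 2)| ≤ η ^ 3 := by
    intro a ha
    refine (Real.cos_bound (ha.trans hη1)).trans ?_
    have : |a| ^ 4 ≤ η ^ 4 := by gcongr
    nlinarith
  have sinb : ∀ a : ℝ, |a| ≤ η → |Real.sin a - a| ≤ η ^ 3 := by
    intro a ha
    have h := Real.sin_bound (ha.trans hη1)
    have h5 : |a| ^ 5 ≤ η ^ 5 := by gcongr
    have h3 : |a| ^ 3 ≤ η ^ 3 := by gcongr
    have : Real.sin a - a = (Real.sin a - (a - a ^ 3 / 6)) + (- (a ^ 3 / 6)) := by ring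
    rw [this]
    refine (abs_add_le _ _).trans ?_
    rw [abs_neg, abs_div, abs_pow, abs_of_pos (by norm_num : (0:ℝ) < 6)]
    linarith
  set V := (1 - q) * a₁ ^ 2 + q * a₂ ^ 2 with hV
  set m := r * ((1 - q) * a₁ - q * a₂) with hm
  have sq1 : a₁ ^ 2 ≤ η ^ 2 := by rw [← sq_abs]; gcongr
  have sq2 : a₂ ^ 2 ≤ η ^ 2 := by rw [← sq_abs a₂]; gcongr
  have hV0 : 0 ≤ V := by positivity
  have hV1 : V ≤ η ^ 2 := by
    calc V ≤ (1 - q) * η ^ 2 + q * η ^ 2 := by rw [hV]; gcongr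
      _ = _ := by ring
  have hconv : ∀ x y z : ℝ, |x| ≤ z → |y| ≤ z → |(1 - q) * x + q * y| ≤ z := by
    intro x y z hx hy
    calc _ ≤ |(1 - q) * x| + |q * y| := abs_add_le _ _
      _ = (1 - q) * |x| + q * |y| := by rw [abs_mul, abs_mul, abs_of_nonneg hq', abs_of_nonneg hq0]
      _ ≤ (1 - q) * z + q * z := by gcongr
      _ = z := by ring
  have hm0 : |(1 - q) * a₁ - q * a₂| ≤ η := by
    have := hconv a₁ (-a₂) η h1 (by rwa [abs_neg])
    convert this using 2
    ring
  have hm1 : |m| ≤ R * η := by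
    rw [hm, abs_mul]
    gcongr
  have hm2 : m ^ 2 ≤ r ^ 2 * η ^ 2 := by
    rw [hm, mul_pow]
    have : ((1 - q) * a₁ - q * a₂) ^ 2 ≤ η ^ 2 := by rw [← sq_abs]; gcongr
    gcongr
  have t1 : |(1 - q) * Real.cos a₁ + q * Real.cos a₂ - (1 - V / 2)| ≤ η ^ 3 := by
    have := hconv _ _ _ (cosb a₁ h1) (cosb a₂ h2)
    convert this using 2
    rw [hV]; ring
  have t2 : |r * ((1 - q) * Real.sin a₁ - q * Real.sin a₂) - m| ≤ R * η ^ 3 := by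
    have := hconv _ _ _ (sinb a₁ h1) (by rw [abs_neg]; exact sinb a₂ h2)
    have e : r * ((1 - q) * Real.sin a₁ - q * Real.sin a₂) - m
      = r * ((1 - q) * (Real.sin a₁ - a₁) + q * -(Real.sin a₂ - a₂)) := by rw [hm]; ring
    rw [e, abs_mul]
    gcongr
  have t3 : ‖Complex.exp (Complex.I * (m : ℂ)) - 1 - Complex.I * (m : ℂ)‖ ≤ r ^ 2 * η ^ 2 := by
    refine (Complex.norm_exp_sub_one_sub_id_le ?_).trans ?_
    · simp; linarith
    · simpa using hm2
  have t4 : ‖((Real.exp (-V / 2) - 1 + V / 2 : ℝ) : ℂ)‖ ≤ η ^ 3 := by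
    rw [Complex.norm_real, Real.norm_eq_abs]
    have hle : η ^ 2 ≤ 1 := by nlinarith
    have := Real.abs_exp_sub_one_sub_id_le (x := -V / 2) (by rw [abs_le]; constructor <;> linarith)
    have e : Real.exp (-V / 2) - 1 + V / 2 = Real.exp (-V / 2) - 1 - -V / 2 := by ring
    rw [e]
    refine this.trans ?_
    have : V ^ 2 ≤ (η ^ 2) ^ 2 := by gcongr
    nlinarith
  have t5 : ‖Complex.exp (Complex.I * (m : ℂ)) - 1‖ ≤ R * η := by
    refine Real.norm_exp_I_mul_ofReal_sub_one_le.trans ?_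
    simpa using hm1
  have t6 : ‖Complex.exp (Complex.I * (m : ℂ))‖ = 1 := by
    rw [mul_comm]; exact Complex.norm_exp_ofReal_mul_I m
  have e : ((((1 - q) * Real.cos a₁ + q * Real.cos a₂ : ℝ) : ℂ)
        + Complex.I * ((r * ((1 - q) * Real.sin a₁ - q * Real.sin a₂) : ℝ) : ℂ))
      - Complex.exp (Complex.I * (m : ℂ)) * ((Real.exp (-V / 2) : ℝ) : ℂ)
      = (((1 - q) * Real.cos a₁ + q * Real.cos a₂ - (1 - V / 2) : ℝ) : ℂ)
        + Complex.I * ((r * ((1 - q) * Real.sin a₁ - q * Real.sin a₂) - m : ℝ) : ℂ)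
        - Complex.exp (Complex.I * (m : ℂ)) * ((Real.exp (-V / 2) - 1 + V / 2 : ℝ) : ℂ)
        - (Complex.exp (Complex.I * (m : ℂ)) - 1) * ((-V / 2 : ℝ) : ℂ)
        - (Complex.exp (Complex.I * (m : ℂ)) - 1 - Complex.I * (m : ℂ)) := by
    push_cast
    ring
  rw [e]
  have n1 := norm_sub_le ((((1 - q) * Real.cos a₁ + q * Real.cos a₂ - (1 - V / 2) : ℝ) : ℂ)
        + Complex.I * ((r * ((1 - q) * Real.sin a₁ - q * Real.sin a₂) - m : ℝ) : ℂ)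
        - Complex.exp (Complex.I * (m : ℂ)) * ((Real.exp (-V / 2) - 1 + V / 2 : ℝ) : ℂ)
        - (Complex.exp (Complex.I * (m : ℂ)) - 1) * ((-V / 2 : ℝ) : ℂ))
        (Complex.exp (Complex.I * (m : ℂ)) - 1 - Complex.I * (m : ℂ))
  have n2 := norm_sub_le ((((1 - q) * Real.cos a₁ + q * Real.cos a₂ - (1 - V / 2) : ℝ) : ℂ)
        + Complex.I * ((r * ((1 - q) * Real.sin a₁ - q * Real.sin a₂) - m : ℝ) : ℂ)
        - Complex.exp (Complex.I * (m : ℂ)) * ((Real.exp (-V / 2) - 1 + V / 2 : ℝ) : ℂ))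
        ((Complex.exp (Complex.I * (m : ℂ)) - 1) * ((-V / 2 : ℝ) : ℂ))
  have n3 := norm_sub_le ((((1 - q) * Real.cos a₁ + q * Real.cos a₂ - (1 - V / 2) : ℝ) : ℂ)
        + Complex.I * ((r * ((1 - q) * Real.sin a₁ - q * Real.sin a₂) - m : ℝ) : ℂ))
        (Complex.exp (Complex.I * (m : ℂ)) * ((Real.exp (-V / 2) - 1 + V / 2 : ℝ) : ℂ))
  have n4 := norm_add_le ((((1 - q) * Real.cos a₁ + q * Real.cos a₂ - (1 - V / 2) : ℝ) : ℂ))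
        (Complex.I * ((r * ((1 - q) * Real.sin a₁ - q * Real.sin a₂) - m : ℝ) : ℂ))
  have s1 : ‖((((1 - q) * Real.cos a₁ + q * Real.cos a₂ - (1 - V / 2) : ℝ) : ℂ))‖ ≤ η ^ 3 := by
    rw [Complex.norm_real]; exact t1
  have s2 : ‖(Complex.I * ((r * ((1 - q) * Real.sin a₁ - q * Real.sin a₂) - m : ℝ) : ℂ))‖
      ≤ R * η ^ 3 := by
    rw [norm_mul, Complex.norm_I, one_mul, Complex.norm_real]; exact t2
  have s3 : ‖Complex.exp (Complex.I * (m : ℂ)) * ((Real.exp (-V / 2) - 1 + V / 2 : ℝ) : ℂ)‖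
      ≤ η ^ 3 := by
    rw [norm_mul, t6, one_mul]; exact t4
  have s4 : ‖(Complex.exp (Complex.I * (m : ℂ)) - 1) * ((-V / 2 : ℝ) : ℂ)‖ ≤ R * η ^ 3 := by
    rw [norm_mul]
    have : ‖((-V / 2 : ℝ) : ℂ)‖ ≤ η ^ 2 := by
      rw [Complex.norm_real, Real.norm_eq_abs, abs_le]
      constructor <;> linarith [sq_nonneg η]
    calc _ ≤ (R * η) * η ^ 2 := by gcongr
      _ = _ := by ring
  have hR3 : η ^ 3 ≤ R * η ^ 3 := le_mul_of_one_le_left p3 hR1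
  linarith


/-- The characteristic function of `Δ₁ + g W` at time `n`. -/
def Psi (P : SEProcess α q Ω) (θ g : ℝ) (n : ℕ) : ℂ :=
  ∫ ω, Complex.exp (Complex.I * ((θ * (((P.Δ n ω).1 : ℝ) + g * Wf α (P.Δ n ω)) : ℝ) : ℂ)) ∂P.μ

/-- The one-step variance. -/
def vf (α q g : ℝ) : ℝ := (1 - q) * (1 + g * (1 + 2 * α)) ^ 2 + q * (1 + g) ^ 2

lemma Psi_step (hα : -1 / 3 ≤ α) (hq0 : 0 ≤ q) (hq1 : q ≤ 1)
    (P : SEProcess α q Ω) (n : ℕ) (hn : 1 ≤ n) (θ g g' R η ρ : ℝ)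
    (hg : g = g' * (1 + gam α q / (Zse α n * (n : ℝ))) + (1 - 2 * q) / (Zse α n * (n : ℝ)))
    (hR : R = 3 * (1 + 2 * |α|)) (hη : R * η ≤ 1)
    (h1 : |θ * (1 + g' * (1 + 2 * α))| ≤ η) (h2 : |θ * (1 + g')| ≤ η)
    (hρ : ∫ ω, (rf α n (P.Δ n ω)) ^ 2 ∂P.μ ≤ ρ) :
    ‖Psi P θ g' (n + 1) - (Real.exp (-(θ ^ 2 * vf α q g') / 2) : ℝ) * Psi P θ g n‖
      ≤ ρ * η ^ 2 + 4 * R * η ^ 3 := by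
  have := P.isProb
  have hR1 : 1 ≤ R := by rw [hR]; nlinarith [abs_nonneg α]
  unfold Psi
  rw [step_complex P n hn (fun x =>
    Complex.exp (Complex.I * ((θ * ((x.1 : ℝ) + g' * Wf α x) : ℝ) : ℂ)))]
  rw [← integral_const_mul]
  have i1 := integrable_f P n hn (fun x => 
      ((((1 + rf α n x) / 2 * (1 - q) : ℝ) : ℂ) * 
        Complex.exp (Complex.I * ((θ * ((((x + (1, 2)).1 : ℤ) : ℝ) + g' * Wf α (x + (1, 2))) : ℝ) : ℂ))
      + (((1 + rf α n x) / 2 * q : ℝ) : ℂ) * 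
        Complex.exp (Complex.I * ((θ * ((((x + (-1, 0)).1 : ℤ) : ℝ) + g' * Wf α (x + (-1, 0))) : ℝ) : ℂ))
      + (((1 - rf α n x) / 2 * q : ℝ) : ℂ) * 
        Complex.exp (Complex.I * ((θ * ((((x + (1, 0)).1 : ℤ) : ℝ) + g' * Wf α (x + (1, 0))) : ℝ) : ℂ))
      + (((1 - rf α n x) / 2 * (1 - q) : ℝ) : ℂ) * 
        Complex.exp (Complex.I * ((θ * ((((x + (-1, -2)).1 : ℤ) : ℝ) + g' * Wf α (x + (-1, -2))) : ℝ) : ℂ))))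
  have i2 := integrable_f P n hn (fun x => ((Real.exp (-(θ ^ 2 * vf α q g') / 2) : ℝ) : ℂ) *
    Complex.exp (Complex.I * ((θ * ((x.1 : ℝ) + g * Wf α x) : ℝ) : ℂ)))
  rw [← integral_sub i1 i2]
  have i3 := integrable_f P n hn (fun x => (rf α n x) ^ 2)
  refine (norm_integral_le_of_norm_le
    (g := fun ω => (rf α n (P.Δ n ω)) ^ 2 * η ^ 2 + 4 * R * η ^ 3)
    ((i3.mul_const _).add (integrable_const _)) ?_).trans ?_
  · refine Filter.Eventually.of_forall fun ω => ?_
    have hr := bound_r hα P n hn ω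
    rw [← hR] at hr
    have key := one_step q (rf α n (P.Δ n ω)) R η (θ * (1 + g' * (1 + 2 * α))) (θ * (1 + g'))
      hq0 hq1 hR1 hr hη h1 h2
    refine le_trans (le_of_eq ?_) key
    set x := P.Δ n ω
    set r := rf α n x with hrdef
    set a₁ := θ * (1 + g' * (1 + 2 * α)) with ha₁
    set a₂ := θ * (1 + g') with ha₂
    have hgW : g * Wf α x = g' * Wf α x + r * (gam α q * g' + (1 - 2 * q)) := by
      rw [hg, hrdef]; unfold rf; ring
    -- the common phase
    set M : ℝ := θ * ((x.1 : ℝ) + g' * Wf α x) with hM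
    have c1 : θ * ((((x + (1, 2)).1 : ℤ) : ℝ) + g' * Wf α (x + (1, 2))) = M + a₁ := by
      rw [hM, ha₁]; simp only [Wf, Prod.fst_add, Prod.snd_add]; push_cast; ring
    have c2 : θ * ((((x + (-1, 0)).1 : ℤ) : ℝ) + g' * Wf α (x + (-1, 0))) = M - a₂ := by
      rw [hM, ha₂]; simp only [Wf, Prod.fst_add, Prod.snd_add]; push_cast; ring
    have c3 : θ * ((((x + (1, 0)).1 : ℤ) : ℝ) + g' * Wf α (x + (1, 0))) = M + a₂ := by
      rw [hM, ha₂]; simp only [Wf, Prod.fst_add, Prod.snd_add]; push_cast; ring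
    have c4 : θ * ((((x + (-1, -2)).1 : ℤ) : ℝ) + g' * Wf α (x + (-1, -2))) = M - a₁ := by
      rw [hM, ha₁]; simp only [Wf, Prod.fst_add, Prod.snd_add]; push_cast; ring
    have c5 : θ * ((x.1 : ℝ) + g * Wf α x) = M + r * ((1 - q) * a₁ - q * a₂) := by
      rw [hgW, hM, ha₁, ha₂]; unfold gam; ring
    have c6 : θ ^ 2 * vf α q g' = (1 - q) * a₁ ^ 2 + q * a₂ ^ 2 := by
      rw [ha₁, ha₂]; unfold vf; ring
    rw [c1, c2, c3, c4, c5, c6]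
    have hE : ‖Complex.exp (Complex.I * (M : ℂ))‖ = 1 := by
      rw [mul_comm]; exact Complex.norm_exp_ofReal_mul_I M
    have ex : ∀ a : ℝ, Complex.exp (Complex.I * ((M + a : ℝ) : ℂ)) =
        Complex.exp (Complex.I * (M : ℂ)) * Complex.exp (Complex.I * (a : ℂ)) := by
      intro a; rw [← Complex.exp_add]; push_cast; ring_nf
    have ex' : ∀ a : ℝ, Complex.exp (Complex.I * ((M - a : ℝ) : ℂ)) =
        Complex.exp (Complex.I * (M : ℂ)) * Complex.exp (Complex.I * ((-a : ℝ) : ℂ)) := by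
      intro a; rw [← Complex.exp_add]; push_cast; ring_nf
    have tr : ∀ a : ℝ, Complex.exp (Complex.I * (a : ℂ)) =
        (Real.cos a : ℂ) + Complex.I * (Real.sin a : ℂ) := by
      intro a
      rw [mul_comm, Complex.exp_mul_I]; push_cast; ring
    rw [ex, ex', ex, ex', ex]
    rw [tr a₁, tr (-a₁), tr a₂, tr (-a₂), Real.cos_neg, Real.sin_neg, Real.cos_neg, Real.sin_neg]
    have hfac : ∀ z : ℂ, ‖z‖ = ‖Complex.exp (Complex.I * (M : ℂ)) * z‖ := by
      intro z; rw [norm_mul, hE, one_mul]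
    conv_rhs => rw [hfac]
    congr 1
    push_cast
    ring
  · rw [integral_add (i3.mul_const _) (integrable_const _), integral_mul_const]
    simp only [integral_const, probReal_univ, one_smul]
    gcongr

lemma norm_Psi_le (P : SEProcess α q Ω) (θ g : ℝ) (n : ℕ) : ‖Psi P θ g n‖ ≤ 1 := by
  have := P.isProb
  unfold Psi
  refine (norm_integral_le_of_norm_le (g := fun _ => (1 : ℝ)) (integrable_const _) ?_).trans ?_
  · refine Filter.Eventually.of_forall fun ω => ?_
    rw [mul_comm, Complex.norm_exp_ofReal_mul_I]
  · simp

lemma Psi_sub_one (P : SEProcess α q Ω) (θ g : ℝ) (n : ℕ) (hn : 1 ≤ n) :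
    ‖Psi P θ g n - 1‖ ≤ |θ| * (n * (1 + |g| * (1 + 2 * |α|))) := by
  have := P.isProb
  have h1 : (1 : ℂ) = ∫ ω, (1 : ℂ) ∂P.μ := by simp
  unfold Psi
  rw [h1, ← integral_sub (integrable_f P n hn (fun x =>
    Complex.exp (Complex.I * ((θ * ((x.1 : ℝ) + g * Wf α x) : ℝ) : ℂ)))) (integrable_const _)]
  refine (norm_integral_le_of_norm_le
    (g := fun _ => |θ| * (n * (1 + |g| * (1 + 2 * |α|)))) (integrable_const _) ?_).trans ?_
  · refine Filter.Eventually.of_forall fun ω => ?_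
    refine Real.norm_exp_I_mul_ofReal_sub_one_le.trans ?_
    rw [Real.norm_eq_abs, abs_mul]
    have hb := bound_W P n hn ω
    have ha : |((P.Δ n ω).1 : ℝ)| ≤ n := by exact_mod_cast (bound_Δ P n hn ω).1
    gcongr
    calc _ ≤ |((P.Δ n ω).1 : ℝ)| + |g * Wf α (P.Δ n ω)| := abs_add_le _ _
      _ = |((P.Δ n ω).1 : ℝ)| + |g| * |Wf α (P.Δ n ω)| := by rw [abs_mul]
      _ ≤ n + |g| * ((1 + 2 * |α|) * n) := by gcongr
      _ = _ := by ring
  · simp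

lemma telescope (Ψ : ℕ → ℂ) (v e : ℕ → ℝ) (n₀ N : ℕ) (hN : n₀ ≤ N)
    (hv : ∀ n, 0 ≤ v n)
    (h : ∀ n, n₀ ≤ n → n < N → ‖Ψ (n + 1) - (Real.exp (-(v n)) : ℝ) * Ψ n‖ ≤ e n) :
    ‖Ψ N - (Real.exp (-(∑ n ∈ Finset.Ico n₀ N, v n)) : ℝ) * Ψ n₀‖
      ≤ ∑ n ∈ Finset.Ico n₀ N, e n := by
  induction N, hN using Nat.le_induction with
  | base => simp
  | succ N hN ih =>
    have ih' := ih (fun n h1 h2 => h n h1 (by omega))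
    rw [Finset.sum_Ico_succ_top hN, Finset.sum_Ico_succ_top hN]
    have h1 := h N hN (by omega)
    have e1 : Ψ (N + 1) - (Real.exp (-(∑ n ∈ Finset.Ico n₀ N, v n + v N)) : ℝ) * Ψ n₀
        = (Ψ (N + 1) - (Real.exp (-(v N)) : ℝ) * Ψ N) + (Real.exp (-(v N)) : ℝ) *
          (Ψ N - (Real.exp (-(∑ n ∈ Finset.Ico n₀ N, v n)) : ℝ) * Ψ n₀) := by
      rw [neg_add, Real.exp_add]; push_cast; ring
    rw [e1]
    refine (norm_add_le _ _).trans ?_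
    rw [norm_mul, Complex.norm_real, Real.norm_eq_abs, abs_of_pos (Real.exp_pos _), add_comm]
    have : Real.exp (-(v N)) ≤ 1 := Real.exp_le_one_iff.2 (by linarith [hv N])
    refine add_le_add ?_ h1
    exact (mul_le_of_le_one_left (norm_nonneg _) this).trans ih'


lemma clt_bound (hα : -1 / 3 ≤ α) (hq0 : 0 ≤ q) (hq1 : q ≤ 1) (P : SEProcess α q Ω)
    (A : ℝ) (hA : 0 < A) (hmom : ∀ n : ℕ, 1 ≤ n →
      ∫ ω, (rf α n (P.Δ n ω)) ^ 2 ∂P.μ ≤ A * (n : ℝ) ^ (-(1 / 2) : ℝ))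
    (b C : ℝ) (hb : 0 < b) (hC : 0 ≤ C) (n₀ N : ℕ) (hn₀ : 1 ≤ n₀) (hN : n₀ ≤ N)
    (g : ℕ → ℝ) (hgN : g N = 0)
    (hrec : ∀ n, n₀ ≤ n → n < N → g n = g (n + 1) * (1 + gam α q / (Zse α n * (n : ℝ)))
      + (1 - 2 * q) / (Zse α n * (n : ℝ)))
    (hbd : ∀ n, n₀ ≤ n → n ≤ N → |g n| ≤ C * ((N : ℝ) / n) ^ b)
    (θ ρ C' R : ℝ) (hρ : ρ = |θ| * (N : ℝ) ^ b) (hC' : C' = 1 + C * (1 + 2 * |α|))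
    (hR : R = 3 * (1 + 2 * |α|)) (hsm : R * (C' * ρ) ≤ 1) :
    ‖Psi P θ 0 N - (Real.exp (-(∑ n ∈ Finset.Ico n₀ N, θ ^ 2 * vf α q (g (n + 1)) / 2)) : ℝ)‖
      ≤ ∑ n ∈ Finset.Ico n₀ N, (A * C' ^ 2 * ρ ^ 2 * (n : ℝ) ^ (-(1 / 2) - 2 * b)
          + 4 * R * C' ^ 3 * ρ ^ 3 * (n : ℝ) ^ (-(3 * b))) + n₀ * C' * ρ := by
  have hR0 : 0 < R := by rw [hR]; positivity
  have hC'1 : 1 ≤ C' := by rw [hC']; nlinarith [mul_nonneg hC (by positivity : 0 ≤ 1 + 2 * |α|)]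
  have hN1 : (1 : ℝ) ≤ N := by exact_mod_cast hn₀.trans hN
  have hρ0 : 0 ≤ ρ := by rw [hρ]; positivity
  have hq' : 0 ≤ 1 - q := by linarith
  -- generic bound
  have gen : ∀ n : ℕ, 1 ≤ n → n ≤ N → ∀ x c : ℝ, |x| ≤ C * ((N : ℝ) / n) ^ b →
      |c| ≤ 1 + 2 * |α| → |θ * (1 + x * c)| ≤ C' * ρ * (n : ℝ) ^ (-b) := by
    intro n hn hnN x c hx hc
    have hn1 : (1 : ℝ) ≤ n := by exact_mod_cast hn
    have hnN' : (n : ℝ) ≤ N := by exact_mod_cast hnN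
    have h1 : 1 ≤ ((N : ℝ) / n) ^ b :=
      Real.one_le_rpow ((one_le_div (by positivity)).2 hnN') hb.le
    have h2 : ((N : ℝ) / n) ^ b = (N : ℝ) ^ b * (n : ℝ) ^ (-b) := by
      rw [Real.div_rpow (by positivity) (by positivity), Real.rpow_neg (by positivity)]
      rfl
    have h3 : |1 + x * c| ≤ C' * ((N : ℝ) / n) ^ b := by
      calc |1 + x * c| ≤ |1| + |x * c| := abs_add_le _ _
        _ = 1 + |x| * |c| := by rw [abs_mul, abs_one]
        _ ≤ ((N : ℝ) / n) ^ b + (C * ((N : ℝ) / n) ^ b) * (1 + 2 * |α|) := by gcongr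
        _ = _ := by rw [hC']; ring
    rw [abs_mul]
    calc |θ| * |1 + x * c| ≤ |θ| * (C' * ((N : ℝ) / n) ^ b) := by gcongr
      _ = _ := by rw [h2, hρ]; ring
  have tel := telescope (fun n => Psi P θ (g n) n)
    (fun n => θ ^ 2 * vf α q (g (n + 1)) / 2)
    (fun n => A * C' ^ 2 * ρ ^ 2 * (n : ℝ) ^ (-(1 / 2) - 2 * b)
          + 4 * R * C' ^ 3 * ρ ^ 3 * (n : ℝ) ^ (-(3 * b))) n₀ N hN
    (fun n => by unfold vf; positivity) ?_
  · simp only [hgN] at tel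
    have h0 := Psi_sub_one P θ (g n₀) n₀ hn₀
    have hn₀1 : (1 : ℝ) ≤ n₀ := by exact_mod_cast hn₀
    have h0' : |θ| * (n₀ * (1 + |g n₀| * (1 + 2 * |α|))) ≤ n₀ * C' * ρ := by
      have h1 : 1 ≤ (N : ℝ) ^ b := Real.one_le_rpow hN1 hb.le
      have h2 : |g n₀| ≤ C * (N : ℝ) ^ b := by
        refine (hbd n₀ le_rfl hN).trans ?_
        gcongr
        exact div_le_self (by positivity) hn₀1
      calc _ ≤ |θ| * (n₀ * ((N : ℝ) ^ b + (C * (N : ℝ) ^ b) * (1 + 2 * |α|))) := by gcongr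
        _ = _ := by rw [hC', hρ]; ring
    set E := Real.exp (-(∑ n ∈ Finset.Ico n₀ N, θ ^ 2 * vf α q (g (n + 1)) / 2)) with hE
    have hE1 : E ≤ 1 := by
      refine Real.exp_le_one_iff.2 (neg_nonpos.2 (Finset.sum_nonneg fun n _ => ?_))
      unfold vf; positivity
    have e : Psi P θ 0 N - (E : ℂ) = (Psi P θ 0 N - E * Psi P θ (g n₀) n₀)
        + E * (Psi P θ (g n₀) n₀ - 1) := by ring
    rw [e]
    refine (norm_add_le _ _).trans (add_le_add tel ?_)
    rw [norm_mul, Complex.norm_real, Real.norm_eq_abs, abs_of_pos (Real.exp_pos _)]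
    exact (mul_le_of_le_one_left (norm_nonneg _) hE1).trans (h0.trans h0')
  · intro n hn hnN
    have hn1 : 1 ≤ n := hn₀.trans hn
    have hn1' : (1 : ℝ) ≤ n := by exact_mod_cast hn1
    have hgb : |g (n + 1)| ≤ C * ((N : ℝ) / n) ^ b := by
      refine (hbd (n + 1) (by omega) (by omega)).trans ?_
      push_cast
      gcongr
      linarith
    have hnb : (n : ℝ) ^ (-b) ≤ 1 := Real.rpow_le_one_of_one_le_of_nonpos hn1' (by linarith)
    have hnb0 : 0 ≤ (n : ℝ) ^ (-b) := by positivity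
    have hη : R * (C' * ρ * (n : ℝ) ^ (-b)) ≤ 1 := by
      calc _ ≤ R * (C' * ρ * 1) := by gcongr
        _ ≤ 1 := by rw [mul_one]; exact hsm
    have h2a : |(1 + 2 * α)| ≤ 1 + 2 * |α| := by
      calc _ ≤ |1| + |2 * α| := abs_add_le _ _
        _ = _ := by rw [abs_mul]; norm_num
    have key := Psi_step hα hq0 hq1 P n hn1 θ (g n) (g (n + 1)) R (C' * ρ * (n : ℝ) ^ (-b))
      (A * (n : ℝ) ^ (-(1 / 2) : ℝ)) (hrec n hn hnN) hR hη
      (gen n hn1 hnN.le _ _ hgb h2a)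
      (by
        have := gen n hn1 hnN.le (g (n + 1)) 1 hgb (by rw [abs_one]; linarith [abs_nonneg α])
        rwa [mul_one] at this)
      (hmom n hn1)
    have e1 : -(θ ^ 2 * vf α q (g (n + 1)) / 2) = -(θ ^ 2 * vf α q (g (n + 1))) / 2 := by ring
    rw [e1]
    refine key.trans (le_of_eq ?_)
    have hp : 0 < (n : ℝ) := by linarith
    have r1 : (n : ℝ) ^ (-(1 / 2) - 2 * b) = (n : ℝ) ^ (-(1 / 2) : ℝ) * ((n : ℝ) ^ (-b)) ^ 2 := by
      rw [← Real.rpow_natCast, ← Real.rpow_mul hp.le, ← Real.rpow_add hp]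
      congr 1; push_cast; ring
    have r2 : (n : ℝ) ^ (-(3 * b)) = ((n : ℝ) ^ (-b)) ^ 3 := by
      rw [← Real.rpow_natCast, ← Real.rpow_mul hp.le]
      congr 1; push_cast; ring
    rw [r1, r2]
    ring

/-- Total variance. -/
def Sf (α q : ℝ) (n₀ : ℕ) (g : ℕ → ℕ → ℝ) (N : ℕ) : ℝ :=
  ∑ n ∈ Finset.Ico n₀ N, vf α q (g N (n + 1))

lemma clt (hα : -1 / 3 ≤ α) (hq0 : 0 ≤ q) (hq1 : q ≤ 1)
    (hgm : 2 * gam α q ≤ 2 * α + 1) (P : SEProcess α q Ω)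
    (b C : ℝ) (hb : 1 / 3 < b) (hC : 0 ≤ C) (n₀ : ℕ) (hn₀ : 1 ≤ n₀)
    (g : ℕ → ℕ → ℝ) (hgN : ∀ N, g N N = 0)
    (hrec : ∀ N n, n₀ ≤ n → n < N → g N n = g N (n + 1) * (1 + gam α q / (Zse α n * (n : ℝ)))
      + (1 - 2 * q) / (Zse α n * (n : ℝ)))
    (hbd : ∀ N n, n₀ ≤ n → n ≤ N → |g N n| ≤ C * ((N : ℝ) / n) ^ b)
    (hS : Tendsto (fun N : ℕ => (N : ℝ) ^ b / Real.sqrt (Sf α q n₀ g N)) atTop (nhds 0))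
    (hSpos : ∀ᶠ N : ℕ in atTop, 0 < Sf α q n₀ g N) (t : ℝ) :
    Tendsto (fun N : ℕ => Psi P (t / Real.sqrt (Sf α q n₀ g N)) 0 N) atTop
      (nhds ((Real.exp (-(t ^ 2 / 2)) : ℝ) : ℂ)) := by
  obtain ⟨A, hA, hmom⟩ := second_moment_r hα hq0 hq1 hgm P
  set C' : ℝ := 1 + C * (1 + 2 * |α|) with hC'
  set R : ℝ := 3 * (1 + 2 * |α|) with hR
  set ρ : ℕ → ℝ := fun N => |t / Real.sqrt (Sf α q n₀ g N)| * (N : ℝ) ^ b with hρ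
  have hR0 : 0 < R := by rw [hR]; positivity
  have hC'0 : 0 < C' := by rw [hC']; positivity
  have hρlim : Tendsto ρ atTop (nhds 0) := by
    have := hS.const_mul |t|
    rw [mul_zero] at this
    refine this.congr fun N => ?_
    simp only [hρ]
    rw [abs_div, abs_of_nonneg (Real.sqrt_nonneg _)]
    ring
  have hρ0 : ∀ N, 0 ≤ ρ N := fun N => by simp only [hρ]; positivity
  have s1 : Summable (fun n : ℕ => (n : ℝ) ^ (-(1 / 2) - 2 * b)) :=
    Real.summable_nat_rpow.2 (by linarith)
  have s2 : Summable (fun n : ℕ => (n : ℝ) ^ (-(3 * b))) :=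
    Real.summable_nat_rpow.2 (by linarith)
  set K1 := ∑' n : ℕ, (n : ℝ) ^ (-(1 / 2) - 2 * b)
  set K2 := ∑' n : ℕ, (n : ℝ) ^ (-(3 * b))
  have hsmall : ∀ᶠ N in atTop, R * (C' * ρ N) ≤ 1 := by
    have : Tendsto (fun N => R * (C' * ρ N)) atTop (nhds 0) := by
      simpa using (hρlim.const_mul C').const_mul R
    exact this.eventually (eventually_le_nhds (by norm_num))
  have hlim : Tendsto (fun N => (A * C' ^ 2 * ρ N ^ 2 * K1 + 4 * R * C' ^ 3 * ρ N ^ 3 * K2)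
      + n₀ * C' * ρ N) atTop (nhds 0) := by
    have h2 := ((hρlim.pow 2).const_mul (A * C' ^ 2)).mul_const K1
    have h3 := ((hρlim.pow 3).const_mul (4 * R * C' ^ 3)).mul_const K2
    have h1 := hρlim.const_mul ((n₀ : ℝ) * C')
    simpa using (h2.add h3).add h1
  rw [tendsto_iff_norm_sub_tendsto_zero]
  refine squeeze_zero' (Eventually.of_forall fun N => norm_nonneg _) ?_ hlim
  filter_upwards [hsmall, hSpos, eventually_ge_atTop n₀] with N h1 h2 h3
  have key := clt_bound hα hq0 hq1 P A hA hmom b C (by linarith) hC n₀ N hn₀ h3 (g N) (hgN N)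
    (hrec N) (hbd N) (t / Real.sqrt (Sf α q n₀ g N)) (ρ N) C' R rfl hC' hR h1
  have e1 : ∑ n ∈ Finset.Ico n₀ N, (t / Real.sqrt (Sf α q n₀ g N)) ^ 2 * vf α q (g N (n + 1)) / 2
      = t ^ 2 / 2 := by
    rw [← Finset.sum_div, ← Finset.mul_sum]
    change (t / Real.sqrt (Sf α q n₀ g N)) ^ 2 * Sf α q n₀ g N / 2 = _
    rw [div_pow, Real.sq_sqrt h2.le]
    field_simp
  rw [e1] at key
  refine key.trans (add_le_add ?_ le_rfl)
  rw [Finset.sum_add_distrib, ← Finset.mul_sum, ← Finset.mul_sum]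
  have hr := hρ0 N
  gcongr
  · exact s1.sum_le_tsum _ fun n _ => by positivity
  · exact s2.sum_le_tsum _ fun n _ => by positivity

/-- Backward recursion. -/
def gAux (A B : ℕ → ℝ) (N : ℕ) : ℕ → ℝ
  | 0 => 0
  | k + 1 => gAux A B N k * A (N - (k + 1)) + B (N - (k + 1))

/-- The coefficients solving the backward recursion with terminal value `0` at `N`. -/
def gf (α q : ℝ) (N n : ℕ) : ℝ :=
  gAux (fun n => 1 + gam α q / (Zse α n * (n : ℝ))) (fun n => (1 - 2 * q) / (Zse α n * (n : ℝ)))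
    N (N - n)

lemma gf_self (N : ℕ) : gf α q N N = 0 := by simp [gf, gAux]

lemma gf_rec (N n : ℕ) (h : n < N) : gf α q N n =
    gf α q N (n + 1) * (1 + gam α q / (Zse α n * (n : ℝ))) + (1 - 2 * q) / (Zse α n * (n : ℝ)) := by
  unfold gf
  have e : N - n = (N - (n + 1)) + 1 := by omega
  rw [e, gAux]
  have e2 : N - (N - (n + 1) + 1) = n := by omega
  rw [e2]

lemma crit_bounds (κ : ℝ) (hκ : 0 ≤ κ) (m h : ℕ → ℝ) (n₀ N : ℕ) (hm : ∀ n, m (n + 1) = m n + 1)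
    (hm0 : ∀ n, n₀ ≤ n → 1 / 2 ≤ m n) (hN : h N = κ)
    (hr : ∀ n, n₀ ≤ n → n < N → h n = h (n + 1) * (1 + 1 / (2 * m n))) (k : ℕ) :
    ∀ n, n₀ ≤ n → n + k = N → 0 ≤ h n ∧ κ ^ 2 * m N ≤ h n ^ 2 * m n ∧
      h n ^ 2 * (m n - 1 / 4) ≤ κ ^ 2 * (m N - 1 / 4) := by
  induction k with
  | zero =>
    intro n hn e
    have : n = N := by omega
    subst this
    rw [hN]
    exact ⟨hκ, le_rfl, le_rfl⟩
  | succ k ih =>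
    intro n hn e
    obtain ⟨i1, i2, i3⟩ := ih (n + 1) (by omega) (by omega)
    have hmn := hm0 n hn
    rw [hm] at i2 i3
    rw [hr n hn (by omega)]
    set x := m n
    set y := h (n + 1)
    have hx : 0 < x := by linarith
    refine ⟨by positivity, i2.trans ?_, le_trans ?_ i3⟩
    · rw [mul_pow, mul_assoc]
      gcongr
      have : (1 + 1 / (2 * x)) ^ 2 * x = x + 1 + 1 / (4 * x) := by field_simp; ring
      rw [this]
      have : 0 < 1 / (4 * x) := by positivity
      linarith
    · rw [mul_pow, mul_assoc]
      gcongr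
      have : (1 + 1 / (2 * x)) ^ 2 * (x - 1 / 4) = x + 3 / 4 - 1 / (16 * x ^ 2) := by
        field_simp; ring
      rw [this]
      have : 0 < 1 / (16 * x ^ 2) := by positivity
      linarith

lemma sub_bound (b C β : ℝ) (hb0 : 0 ≤ b) (hb : b ≤ 1) (hC : 0 ≤ C) (g s a: ℕ → ℝ) (n₀ N : ℕ)
    (hn₀ : 1 ≤ n₀) (hN : g N = 0) (hβ : 0 ≤ β)
    (ha : ∀ n, n₀ ≤ n → 0 ≤ a n ∧ a n ≤ 1 + β * s n) (hs : ∀ n, n₀ ≤ n → 0 ≤ s n) (e : ℝ)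
    (hr : ∀ n, n₀ ≤ n → n < N → g n = g (n + 1) * a n + e * s n)
    (hc : ∀ n : ℕ, n₀ ≤ n → |e| * s n ≤ C * (b / ((n : ℝ) + 1) - β * s n)) (k : ℕ) :
    ∀ n, n₀ ≤ n → n + k = N → |g n| ≤ C * (((N : ℝ) / n) ^ b - 1) := by
  induction k with
  | zero =>
    intro n hn e
    have : n = N := by omega
    subst this
    have : (n : ℝ) ≠ 0 := by have : 1 ≤ n := by omega
                             positivity
    rw [hN, div_self this]; simp
  | succ k ih =>
    intro n hn en
    have i := ih (n + 1) (by omega) (by omega)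
    obtain ⟨a0, a1⟩ := ha n hn
    have s0 := hs n hn
    have c := hc n hn
    have hnp : (0 : ℝ) < n := by have : 1 ≤ n := by omega
                                 positivity
    have hNn : (n : ℝ) ≤ N := by exact_mod_cast (by omega : n ≤ N)
    have hX : 1 ≤ ((N : ℝ) / n) ^ b := Real.one_le_rpow (by rw [le_div_iff₀ hnp]; linarith) hb0
    have hY : ((N : ℝ) / ((n + 1 : ℕ) : ℝ)) ^ b ≤ ((N : ℝ) / n) ^ b * (1 - b / ((n : ℝ) + 1)) := by
      have : (N : ℝ) / ((n + 1 : ℕ) : ℝ) = (N : ℝ) / n * (1 + (-(1 / ((n : ℝ) + 1)))) := by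
        push_cast; field_simp; ring
      rw [this, Real.mul_rpow (by positivity)]
      · have h1 : -1 ≤ -(1 / ((n : ℝ) + 1)) := by
          rw [neg_le_neg_iff, div_le_one (by positivity)]; linarith
        have := _root_.rpow_one_add_le_one_add_mul_self h1 hb0 hb
        gcongr
        refine this.trans (le_of_eq (by ring))
      · have : 1 / ((n : ℝ) + 1) ≤ 1 := by rw [div_le_one (by positivity)]; linarith
        linarith
    set X := ((N : ℝ) / n) ^ b
    set Y := ((N : ℝ) / ((n + 1 : ℕ) : ℝ)) ^ b
    set d := b / ((n : ℝ) + 1)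
    have hd : 0 ≤ d := by positivity
    rw [hr n hn (by omega)]
    have h1 : |g (n + 1) * a n + e * s n| ≤ C * (Y - 1) * (1 + β * s n) + |e| * s n := by
      refine (abs_add_le _ _).trans ?_
      rw [abs_mul, abs_mul, abs_of_nonneg a0, abs_of_nonneg s0]
      have := (abs_nonneg _).trans i
      gcongr
    refine h1.trans ?_
    have hbs : 0 ≤ β * s n := by positivity
    have h2 : C * (Y - 1) * (1 + β * s n) ≤ C * (X * (1 - d) - 1) * (1 + β * s n) := by gcongr
    have h3 : 0 ≤ C * (d - β * s n) := (by positivity : 0 ≤ |e| * s n).trans c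
    have h4 : 0 ≤ C * X * d * (β * s n) := by positivity
    have h5 : 0 ≤ C * (d - β * s n) * (X - 1) := mul_nonneg h3 (by linarith)
    nlinarith

/-- All the hypotheses of `clt` are met. -/
def Good (α q : ℝ) : Prop := ∃ b C : ℝ, 1 / 3 < b ∧ 0 ≤ C ∧ ∃ n₀ : ℕ, 1 ≤ n₀ ∧
  (∀ N n, n₀ ≤ n → n ≤ N → |gf α q N n| ≤ C * ((N : ℝ) / n) ^ b) ∧
  Tendsto (fun N : ℕ => Sf α q n₀ (gf α q) N / (N : ℝ) ^ (2 * b)) atTop atTop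

lemma vf_nonneg (hq0 : 0 ≤ q) (hq1 : q ≤ 1) (g : ℝ) : 0 ≤ vf α q g := by
  have : 0 ≤ 1 - q := by linarith
  unfold vf; positivity

lemma good_crit (hα : -1 / 3 ≤ α) (hq0 : 0 ≤ q) (hq1 : q ≤ 1) (hgm : 2 * gam α q = 2 * α + 1) :
    Good α q := by
  have hα1 : 0 < α + 1 := by linarith
  have hα2 : 0 < 2 * α + 1 := by linarith
  have hqe : q * (4 * (α + 1)) = 2 * α + 1 := by unfold gam at hgm; linarith
  have hq : 0 < q := by
    rcases hq0.lt_or_eq with h | h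
    · exact h
    · rw [← h] at hqe; linarith
  have he : 0 < 1 - 2 * q := by
    have : (1 - 2 * q) * (2 * (α + 1)) = 1 := by linarith
    by_contra h
    have := mul_nonneg (by linarith : 0 ≤ -(1 - 2 * q)) (by linarith : 0 ≤ 2 * (α + 1))
    linarith
  have hγ : 0 < gam α q := by linarith
  set κ := (1 - 2 * q) / gam α q with hκ
  have hκ0 : 0 < κ := by positivity
  set c := 2 * α / (2 * α + 1) with hc
  have hc1 : c ≤ 1 := by rw [hc, div_le_one hα2]; linarith
  have hc2 : -2 ≤ c := by rw [hc, le_div_iff₀ hα2]; linarith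
  set m : ℕ → ℝ := fun n => n - c with hm
  have hT : ∀ n : ℕ, 1 ≤ n → Zse α n * (n : ℝ) = (2 * α + 1) * m n := by
    intro n hn
    rw [Zn_eq α n hn, hm, hc]
    field_simp
  have key : ∀ N n, 2 ≤ n → n ≤ N → 0 ≤ gf α q N n + κ ∧
      κ ^ 2 * m N ≤ (gf α q N n + κ) ^ 2 * m n ∧
      (gf α q N n + κ) ^ 2 * (m n - 1 / 4) ≤ κ ^ 2 * (m N - 1 / 4) := by
    intro N n hn hnN
    refine crit_bounds κ hκ0.le m (fun n => gf α q N n + κ) 2 N ?_ ?_ ?_ ?_ (N - n) n hn (by omega)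
    · intro n; simp only [hm]; push_cast; ring
    · intro n hn
      have : (2 : ℝ) ≤ n := by exact_mod_cast hn
      simp only [hm]; linarith
    · simp [gf_self]
    · intro n hn hnN
      have h2 : (2 : ℝ) ≤ n := by exact_mod_cast hn
      have hmp : 0 < m n := by simp only [hm]; linarith
      rw [gf_rec N n hnN, hT n (by omega)]
      have e1 : gam α q / ((2 * α + 1) * m n) = 1 / (2 * m n) := by
        rw [← hgm]; field_simp
      have e2 : (1 - 2 * q) / ((2 * α + 1) * m n) = κ * (1 / (2 * m n)) := by
        rw [← hgm, hκ]; field_simp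
      rw [e1, e2]
      ring
  refine ⟨1 / 2, 4 * κ, by norm_num, by positivity, 2, by norm_num, ?_, ?_⟩
  · intro N n hn hnN
    obtain ⟨k1, k2, k3⟩ := key N n hn hnN
    set h := gf α q N n + κ with hh
    have h2 : (2 : ℝ) ≤ n := by exact_mod_cast hn
    have h3 : (n : ℝ) ≤ N := by exact_mod_cast hnN
    have hnp : (0 : ℝ) < n := by linarith
    have h4 : h ^ 2 * (3 / 8 * n) ≤ κ ^ 2 * (2 * N) := by
      refine le_trans ?_ (k3.trans ?_)
      · gcongr; simp only [hm]; linarith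
      · gcongr; simp only [hm]; linarith
    rw [← Real.sqrt_eq_rpow]
    have h5 : h ≤ 3 * κ * Real.sqrt ((N : ℝ) / n) := by
      apply abs_le_of_sq_le_sq' _ (by positivity) |>.2
      rw [mul_pow, Real.sq_sqrt (by positivity), mul_div_assoc', le_div_iff₀ hnp]
      nlinarith [mul_nonneg (sq_nonneg κ) (by linarith : (0 : ℝ) ≤ N)]
    have h6 : 1 ≤ Real.sqrt ((N : ℝ) / n) := by
      rw [Real.one_le_sqrt, le_div_iff₀ hnp]; linarith
    have h7 : κ ≤ κ * Real.sqrt ((N : ℝ) / n) := le_mul_of_one_le_right hκ0.le h6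
    rw [abs_le]
    constructor <;> linarith
  · have hsum : Tendsto (fun N : ℕ => q * (κ ^ 2 / 4 * (∑ n ∈ Finset.range N, 1 / ((n : ℝ) + 3)
        - ∑ n ∈ Finset.range 2, 1 / ((n : ℝ) + 3)) - (1 - κ) ^ 2)) atTop atTop := by
      have h0 : Tendsto (fun N : ℕ => ∑ n ∈ Finset.range N, 1 / ((n : ℝ) + 3)) atTop atTop := by
        refine (not_summable_iff_tendsto_nat_atTop_of_nonneg fun n => by positivity).1 ?_
        exact_mod_cast mt (_root_.summable_nat_add_iff 3).1 Real.not_summable_one_div_natCast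
      refine Tendsto.const_mul_atTop hq ?_
      simp only [sub_eq_add_neg]
      refine tendsto_atTop_add_const_right _ _ ?_
      refine Tendsto.const_mul_atTop (by positivity) ?_
      exact tendsto_atTop_add_const_right _ _ h0
    refine tendsto_atTop_mono' _ ?_ hsum
    filter_upwards [eventually_ge_atTop 2] with N hN
    have hN2 : (2 : ℝ) ≤ N := by exact_mod_cast hN
    rw [← Finset.sum_Ico_eq_sub _ hN]
    have e : (2 : ℝ) * (1 / 2) = 1 := by norm_num
    rw [e, Real.rpow_one, le_div_iff₀ (by linarith)]
    unfold Sf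
    have hcard : ∑ n ∈ Finset.Ico 2 N, (1 - κ) ^ 2 ≤ N * (1 - κ) ^ 2 := by
      rw [Finset.sum_const, Nat.card_Ico, nsmul_eq_mul]
      gcongr
      omega
    calc _ = q * (∑ n ∈ Finset.Ico 2 N, κ ^ 2 / 4 * (1 / ((n : ℝ) + 3)) * N - N * (1 - κ) ^ 2) := by
          rw [← Finset.sum_mul, ← Finset.mul_sum]; ring
      _ ≤ q * (∑ n ∈ Finset.Ico 2 N, κ ^ 2 / 4 * (1 / ((n : ℝ) + 3)) * N
            - ∑ n ∈ Finset.Ico 2 N, (1 - κ) ^ 2) := by gcongr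
      _ = ∑ n ∈ Finset.Ico 2 N, q * (κ ^ 2 / 4 * (1 / ((n : ℝ) + 3)) * N - (1 - κ) ^ 2) := by
          rw [← Finset.sum_sub_distrib, Finset.mul_sum]
      _ ≤ _ := by
          refine Finset.sum_le_sum fun n hn => ?_
          rw [Finset.mem_Ico] at hn
          obtain ⟨k1, k2, k3⟩ := key N (n + 1) (by omega) (by omega)
          set g := gf α q N (n + 1)
          have hq' : 0 ≤ 1 - q := by linarith
          have v1 : q * (1 + g) ^ 2 ≤ vf α q g := by
            unfold vf
            have : 0 ≤ (1 - q) * (1 + g * (1 + 2 * α)) ^ 2 := by positivity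
            linarith
          refine le_trans ?_ v1
          gcongr
          have hn3 : (0 : ℝ) < (n : ℝ) + 3 := by positivity
          have h1 : κ ^ 2 * (N / 2) ≤ (g + κ) ^ 2 * ((n : ℝ) + 3) := by
            refine le_trans ?_ (k2.trans ?_)
            · gcongr; simp only [hm]; linarith
            · gcongr; simp only [hm]; push_cast; linarith
          have h2 : κ ^ 2 / 4 * (1 / ((n : ℝ) + 3)) * N ≤ (g + κ) ^ 2 / 2 := by
            have : κ ^ 2 / 4 * (1 / ((n : ℝ) + 3)) * N = κ ^ 2 * (N / 2) / ((n : ℝ) + 3) / 2 := by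
              field_simp; ring
            rw [this]
            gcongr
            rwa [div_le_iff₀ hn3]
          nlinarith [sq_nonneg ((g + κ) + 2 * (1 - κ))]

set_option maxHeartbeats 1000000 in
lemma good_sub (hα : -1 / 3 ≤ α) (hq0 : 0 ≤ q) (hq1 : q ≤ 1) (hgm : 2 * gam α q < 2 * α + 1) :
    Good α q := by
  have hα2 : 0 < 2 * α + 1 := by linarith
  set γ := gam α q with hγ
  set γp := max γ 0 with hγp
  have hγp0 : 0 ≤ γp := le_max_right _ _
  have hγγ : γ ≤ γp := le_max_left _ _
  have hβ : max (γp / (2 * α + 1)) (1 / 3) < 1 / 2 := by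
    refine max_lt ?_ (by norm_num)
    rw [div_lt_iff₀ hα2]
    exact max_lt (by linarith) (by linarith)
  obtain ⟨b, hb1, hb2⟩ := exists_between hβ
  have hb3 : 1 / 3 < b := (le_max_right _ _).trans_lt hb1
  have hbγ : 0 < b * (2 * α + 1) - γp := by
    have := (le_max_left _ _).trans_lt hb1
    rw [div_lt_iff₀ hα2] at this
    linarith
  set e := 1 - 2 * q with he
  set C := (|e| + 1) / (b * (2 * α + 1) - γp) with hC
  have hC0 : 0 < C := by positivity
  have hCe : C * (b * (2 * α + 1) - γp) = |e| + 1 := by rw [hC]; field_simp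
  obtain ⟨n₁, hn₁⟩ := exists_nat_ge (|e| + C * γp + 2 * |α| * C * b)
  obtain ⟨n₂, hn₂⟩ := exists_nat_ge (3 * |γ|)
  set n₀ := max 1 (max n₁ n₂) with hn₀
  have hn01 : 1 ≤ n₀ := le_max_left _ _
  have hb0 : 0 < b := by linarith
  have bd : ∀ N n, n₀ ≤ n → n ≤ N → |gf α q N n| ≤ C * (((N : ℝ) / n) ^ b - 1) := by
    intro N n hn hnN
    refine sub_bound b C γp (by linarith) (by linarith) hC0.le (gf α q N)
      (fun n => 1 / (Zse α n * (n : ℝ))) (fun n => 1 + γ / (Zse α n * (n : ℝ))) n₀ N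
      hn01 (gf_self N) hγp0 ?_ ?_ e ?_ ?_ (N - n) n hn (by omega)
    · intro n hn
      have h1 : (1 : ℝ) ≤ n := by exact_mod_cast hn01.trans hn
      have hT := Zn_ge hα n (hn01.trans hn)
      have hTp : 0 < Zse α n * (n : ℝ) := by linarith
      have h2 : (n₂ : ℝ) ≤ n := by exact_mod_cast (le_max_right _ _).trans ((le_max_right _ _).trans hn)
      constructor
      · have : -1 ≤ γ / (Zse α n * (n : ℝ)) := by
          rw [le_div_iff₀ hTp]
          linarith [neg_abs_le γ]
        linarith
      · rw [div_eq_mul_one_div]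
        gcongr
    · intro n hn
      have h1 : (1 : ℝ) ≤ n := by exact_mod_cast hn01.trans hn
      have hT := Zn_ge hα n (hn01.trans hn)
      have hTp : 0 < Zse α n * (n : ℝ) := by linarith
      positivity
    · intro n hn hnN
      rw [gf_rec N n hnN]
      ring
    · intro n hn
      have h1 : (1 : ℝ) ≤ n := by exact_mod_cast hn01.trans hn
      have hT := Zn_ge hα n (hn01.trans hn)
      have hTp : 0 < Zse α n * (n : ℝ) := by linarith
      have h2 : (n₁ : ℝ) ≤ n := by exact_mod_cast (le_max_left _ _).trans ((le_max_right _ _).trans hn)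
      have hTe := Zn_eq α n (hn01.trans hn)
      set T := Zse α n * (n : ℝ)
      have h3 : (|e| + C * γp) * ((n : ℝ) + 1) ≤ C * b * T := by
        rw [hTe]
        have : C * b * ((2 * α + 1) * n - 2 * α) = (|e| + 1 + C * γp) * n - 2 * α * C * b := by
          rw [← hCe]; ring
        rw [this]
        have : 2 * α * C * b ≤ 2 * |α| * C * b := by gcongr; exact le_abs_self α
        linarith
      have h4 : |e| * (1 / T) + C * (γp * (1 / T)) ≤ C * (b / ((n : ℝ) + 1)) := by
        have e1 : |e| * (1 / T) + C * (γp * (1 / T)) = (|e| + C * γp) / T := by ring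
        have e2 : C * (b / ((n : ℝ) + 1)) = C * b / ((n : ℝ) + 1) := by ring
        rw [e1, e2, div_le_div_iff₀ hTp (by positivity)]
        exact h3
      linarith
  refine ⟨b, C, hb3, hC0.le, n₀, hn01, ?_, ?_⟩
  · intro N n hn hnN
    refine (bd N n hn hnN).trans ?_
    gcongr
    linarith
  · obtain ⟨K', hK'⟩ := exists_nat_ge (2 * C * (1 + 2 * |α|))
    set K := K' + 1 with hK
    have hKC : 2 * C * (1 + 2 * |α|) ≤ K := by rw [hK]; push_cast; linarith
    have hK0 : (1 : ℝ) ≤ K := by rw [hK]; push_cast; linarith [Nat.cast_nonneg (α := ℝ) K']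
    have hlim : Tendsto (fun N : ℕ => 1 / (8 * ((K : ℝ) + 1)) * (N : ℝ) ^ (1 - 2 * b)) atTop atTop :=
      Tendsto.const_mul_atTop (by positivity)
        ((tendsto_rpow_atTop (by linarith)).comp tendsto_natCast_atTop_atTop)
    refine tendsto_atTop_mono' _ ?_ hlim
    filter_upwards [eventually_ge_atTop (2 * (K + 1)), eventually_ge_atTop (2 * n₀)] with N hN1 hN2
    have hNp : (0 : ℝ) < N := by
      have : 0 < N := by omega
      exact_mod_cast this
    have hN1' : 2 * ((K : ℝ) + 1) ≤ N := by exact_mod_cast hN1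
    set M := N / (K + 1) with hM
    have hM1 : M * (K + 1) ≤ N := Nat.div_mul_le_self _ _
    have hM2 : N < (M + 1) * (K + 1) := by
      rw [mul_comm]; exact Nat.lt_mul_div_succ N (Nat.succ_pos K)
    have hM1' : (M : ℝ) * (K + 1) ≤ N := by exact_mod_cast hM1
    have hM2' : (N : ℝ) < (M + 1) * (K + 1) := by exact_mod_cast hM2
    have hM3 : (N : ℝ) / (2 * (K + 1)) ≤ M := by
      rw [div_le_iff₀ (by positivity)]; nlinarith
    have hMN : 2 * M ≤ N := by
      have : 2 * M ≤ M * (K + 1) := by rw [mul_comm]; gcongr; omega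
      omega
    have hS : 1 / 4 * (M : ℝ) ≤ Sf α q n₀ (gf α q) N := by
      unfold Sf
      have hsub : Finset.Ico (N - M) N ⊆ Finset.Ico n₀ N := Finset.Ico_subset_Ico (by omega) le_rfl
      refine le_trans ?_ (Finset.sum_le_sum_of_subset_of_nonneg hsub
        fun n _ _ => vf_nonneg hq0 hq1 _)
      have : 1 / 4 * (M : ℝ) = ∑ n ∈ Finset.Ico (N - M) N, (1 / 4 : ℝ) := by
        rw [Finset.sum_const, Nat.card_Ico, nsmul_eq_mul, Nat.sub_sub_self (by omega)]
        ring
      rw [this]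
      refine Finset.sum_le_sum fun n hn => ?_
      rw [Finset.mem_Ico] at hn
      have hb := bd N (n + 1) (by omega) (by omega)
      set g := gf α q N (n + 1)
      set k := n + 1 with hk
      have hkN : (k : ℝ) ≤ N := by exact_mod_cast (by omega : k ≤ N)
      have hkM : (N : ℝ) ≤ k + M := by exact_mod_cast (by omega : N ≤ k + M)
      have hkp : (0 : ℝ) < k := by rw [hk]; positivity
      have h1 : 1 ≤ (N : ℝ) / k := by rw [le_div_iff₀ hkp]; linarith
      have h2 : ((N : ℝ) / k) ^ b ≤ N / k := by
        calc ((N : ℝ) / k) ^ b ≤ ((N : ℝ) / k) ^ (1 : ℝ) :=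
              Real.rpow_le_rpow_of_exponent_le h1 (by linarith)
          _ = _ := Real.rpow_one _
      have h3 : (N : ℝ) / k - 1 ≤ 1 / K := by
        have hMK : (M : ℝ) * K ≤ k := by nlinarith
        rw [div_sub_one hkp.ne', div_le_div_iff₀ hkp (by linarith)]
        nlinarith
      have h4 : |g| * (1 + 2 * |α|) ≤ 1 / 2 := by
        calc |g| * (1 + 2 * |α|) ≤ C * (1 / K) * (1 + 2 * |α|) := by
              gcongr; exact hb.trans (by gcongr; linarith)
          _ = (2 * C * (1 + 2 * |α|)) / K / 2 := by ring
          _ ≤ 1 / 2 := by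
              gcongr
              rw [div_le_one (by linarith)]; exact hKC
      have h5 : |g| ≤ 1 / 2 := by
        have : 0 ≤ |g| * (2 * |α|) := by positivity
        linarith
      have h6 : |g * (1 + 2 * α)| ≤ 1 / 2 := by
        rw [abs_mul]
        refine le_trans ?_ h4
        gcongr
        refine (abs_add_le _ _).trans ?_
        rw [abs_one, abs_mul, abs_two]
      rw [abs_le] at h5 h6
      unfold vf
      have hq' : 0 ≤ 1 - q := by linarith
      have h7 : (1 - q) * (1 / 4) ≤ (1 - q) * (1 + g * (1 + 2 * α)) ^ 2 := by
        gcongr; nlinarith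
      have h8 : q * (1 / 4) ≤ q * (1 + g) ^ 2 := by
        gcongr; nlinarith
      linarith
    rw [le_div_iff₀ (by positivity), mul_assoc, ← Real.rpow_add hNp]
    have : (1 - 2 * b + 2 * b) = 1 := by ring
    rw [this, Real.rpow_one]
    refine le_trans ?_ hS
    have : 1 / (8 * ((K : ℝ) + 1)) * N = 1 / 4 * (N / (2 * (K + 1))) := by field_simp; ring
    rw [this]
    gcongr


lemma final (hα : -1 / 3 ≤ α) (hq0 : 0 ≤ q) (hq1 : q ≤ 1) (hgm : 2 * gam α q ≤ 2 * α + 1)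
    (P : SEProcess α q Ω) :
    Tendsto (fun N : ℕ => (P.μ {ω | (P.Δ N ω).1 < 0}).toReal +
          (1 / 2) * (P.μ {ω | (P.Δ N ω).1 = 0}).toReal) atTop (nhds (1 / 2)) := by
  have := P.isProb
  have hgood : Good α q := by
    rcases hgm.lt_or_eq with h | h
    · exact good_sub hα hq0 hq1 h
    · exact good_crit hα hq0 hq1 h
  obtain ⟨b, C, hb, hC, n₀, hn₀, hbd, hlim⟩ := hgood
  set S := Sf α q n₀ (gf α q) with hSdef
  have hSpos : ∀ᶠ N in atTop, 0 < S N := by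
    filter_upwards [hlim.eventually_gt_atTop 0] with N hN
    by_contra h
    have := div_nonpos_of_nonpos_of_nonneg (not_lt.1 h)
      (by positivity : (0 : ℝ) ≤ (N : ℝ) ^ (2 * b))
    linarith
  have hS : Tendsto (fun N : ℕ => (N : ℝ) ^ b / Real.sqrt (S N)) atTop (nhds 0) := by
    have h1 : Tendsto (fun N : ℕ => (Real.sqrt (S N / (N : ℝ) ^ (2 * b)))⁻¹) atTop (nhds 0) :=
      tendsto_inv_atTop_zero.comp (Real.tendsto_sqrt_atTop.comp hlim)
    refine h1.congr fun N => ?_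
    have e : (N : ℝ) ^ (2 * b) = ((N : ℝ) ^ b) ^ 2 := by
      rw [← Real.rpow_natCast, ← Real.rpow_mul (by positivity)]
      congr 1; push_cast; ring
    rw [e, Real.sqrt_div' _ (by positivity), Real.sqrt_sq (by positivity), inv_div]
  have hclt := clt hα hq0 hq1 hgm P b C hb hC n₀ hn₀ (gf α q) gf_self
    (fun N n _ h => gf_rec N n h) hbd hS hSpos
  have hmeas : ∀ N : ℕ, Measurable (fun ω => ((P.Δ (N + 1) ω).1 : ℝ) / Real.sqrt (S (N + 1))) := by
    intro N
    have h1 : Measurable (fun ω => (P.Δ (N + 1) ω).1) := (meas_Δ P (N + 1) (by omega)).fst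
    have h2 : Measurable (fun ω => ((P.Δ (N + 1) ω).1 : ℝ)) :=
      (measurable_of_countable (fun z : ℤ => (z : ℝ))).comp h1
    exact h2.div_const _
  let ν : ℕ → ProbabilityMeasure ℝ := fun N =>
    ⟨P.μ.map (fun ω => ((P.Δ (N + 1) ω).1 : ℝ) / Real.sqrt (S (N + 1))),
      Measure.isProbabilityMeasure_map (hmeas N).aemeasurable⟩
  let G : ProbabilityMeasure ℝ := ⟨ProbabilityTheory.gaussianReal 0 1, inferInstance⟩
  have hν : Tendsto ν atTop (nhds G) := by
    refine ProbabilityMeasure.tendsto_of_tendsto_charFun fun t => ?_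
    have e1 : charFun (G : Measure ℝ) t = ((Real.exp (-(t ^ 2 / 2)) : ℝ) : ℂ) := by
      change charFun (ProbabilityTheory.gaussianReal 0 1) t = _
      rw [ProbabilityTheory.charFun_gaussianReal]
      push_cast
      congr 1
      simp
    rw [e1]
    refine ((hclt t).comp (tendsto_add_atTop_nat 1)).congr fun N => ?_
    simp only [Function.comp]
    change _ = charFun (P.μ.map _) t
    rw [charFun_apply_real, integral_map (hmeas N).aemeasurable (by fun_prop)]
    unfold Psi
    refine integral_congr_ae (Eventually.of_forall fun ω => ?_)
    simp only
    congr 1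
    push_cast
    ring
  have : NullSingletonClass (ProbabilityTheory.gaussianReal 0 1) :=
    ProbabilityTheory.nullSingletonClass_gaussianReal (by norm_num)
  have h0 : (G : Measure ℝ) {0} = 0 := by
    change ProbabilityTheory.gaussianReal 0 1 {0} = 0
    exact measure_singleton 0
  have hneg : (G : Measure ℝ) (Set.Iio 0) = 1 / 2 := by
    change ProbabilityTheory.gaussianReal 0 1 (Set.Iio 0) = 1 / 2
    have hsym : ProbabilityTheory.gaussianReal 0 1 (Set.Ioi 0)
        = ProbabilityTheory.gaussianReal 0 1 (Set.Iio 0) := by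
      have := ProbabilityTheory.gaussianReal_map_neg (μ := 0) (v := 1)
      rw [neg_zero] at this
      conv_lhs => rw [← this]
      rw [Measure.map_apply (by fun_prop) measurableSet_Ioi]
      congr 1
      ext x; simp
    have htot : ProbabilityTheory.gaussianReal 0 1 (Set.Iio 0)
        + ProbabilityTheory.gaussianReal 0 1 (Set.Ioi 0) = 1 := by
      rw [← measure_congr (Ioi_ae_eq_Ici' (measure_singleton 0)).symm, ← Set.compl_Iio,
        measure_add_measure_compl measurableSet_Iio, measure_univ]
    rw [hsym, ← two_mul] at htot
    rw [ENNReal.eq_div_iff (by norm_num) (by norm_num)]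
    exact htot
  have t1 := ProbabilityMeasure.tendsto_measure_of_null_frontier_of_tendsto' hν (E := Set.Iio 0)
    (by rw [frontier_Iio]; exact h0)
  have t2 := ProbabilityMeasure.tendsto_measure_of_null_frontier_of_tendsto' hν (E := {0})
    (measure_mono_null ((frontier_subset_closure).trans closure_singleton.subset) h0)
  rw [hneg] at t1
  rw [h0] at t2
  have t1' := (ENNReal.tendsto_toReal (by norm_num)).comp t1
  have t2' := (ENNReal.tendsto_toReal (by norm_num)).comp t2
  have t3 := t1'.add (t2'.const_mul (1 / 2))
  have e : (1 / 2 : ENNReal).toReal + 1 / 2 * (0 : ENNReal).toReal = 1 / 2 := by simp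
  rw [e] at t3
  rw [← tendsto_add_atTop_iff_nat 1]
  refine t3.congr' ?_
  filter_upwards [(tendsto_add_atTop_nat 1).eventually hSpos] with N hN
  have hs : 0 < Real.sqrt (S (N + 1)) := Real.sqrt_pos.2 hN
  simp only [Function.comp]
  change (P.μ.map _ (Set.Iio 0)).toReal + 1 / 2 * (P.μ.map _ {0}).toReal = _
  rw [Measure.map_apply (hmeas N) measurableSet_Iio,
    Measure.map_apply (hmeas N) (measurableSet_singleton 0)]
  have s1 : (fun ω => ((P.Δ (N + 1) ω).1 : ℝ) / Real.sqrt (S (N + 1))) ⁻¹' (Set.Iio 0)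
      = {ω | (P.Δ (N + 1) ω).1 < 0} := by
    ext ω
    simp only [Set.mem_preimage, Set.mem_Iio, Set.mem_ofPred_eq, div_lt_iff₀ hs, zero_mul,
      Int.cast_lt_zero]
  have s2 : (fun ω => ((P.Δ (N + 1) ω).1 : ℝ) / Real.sqrt (S (N + 1))) ⁻¹' {0}
      = {ω | (P.Δ (N + 1) ω).1 = 0} := by
    ext ω
    simp only [Set.mem_preimage, Set.mem_singleton_iff, Set.mem_ofPred_eq, div_eq_zero_iff,
      hs.ne', or_false, Int.cast_eq_zero]
  rw [s1, s2]

end SEaux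

end

/-- `R_maj(q) = 1/2` for `q ≥ (2α+1)/(4(α+1))` on shape exchangeable trees: the limsup of the
error probability `μ(Δ₁(N) < 0) + (1/2)μ(Δ₁(N) = 0)` of the majority estimator is `1/2`. -/
theorem se_majority_impossibility (α q : ℝ) (hα : α ∈ seAllowed)
    (hq0 : 0 ≤ q) (hq1 : q ≤ 1) (hq : (2 * α + 1) / (4 * (α + 1)) ≤ q)
    (Ω : Type) [MeasurableSpace Ω] (P : SEProcess α q Ω) :
    Filter.limsup (fun N : ℕ =>
        (P.μ {ω | (P.Δ N ω).1 < 0}).toReal +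
          (1 / 2) * (P.μ {ω | (P.Δ N ω).1 = 0}).toReal)
      Filter.atTop = 1 / 2 := by
  have h1 := SEaux.alpha_ge hα
  have hgm : 2 * SEaux.gam α q ≤ 2 * α + 1 := by
    rw [div_le_iff₀ (by linarith)] at hq
    unfold SEaux.gam
    linarith
  exact (SEaux.final h1 hq0 hq1 hgm P).limsup_eq
end

section
/- Let α ∈ {−1/d : d ∈ ℕ, d ≥ 3} ∪ [0,∞). There exists a constant c_α > 0, depending only on α, such that for every q ∈ [0,1] and every shape exchangeable color-difference process (Δ(n))_{n≥1} with parameters (α, q) on a probability space (Ω, 𝒜, μ): limsup_{N→∞} [ μ(Δ₁(N) < 0) + (1/2)·μ(Δ₁(N) = 0) ] ≤ c_α·√q. -/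
open MeasureTheory Filter
open scoped ENat

namespace SEP
variable {α q : ℝ} {Ω : Type} [mΩ : MeasurableSpace Ω] (P : SEProcess α q Ω)

lemma iadd {μ : Measure Ω} {f g : Ω → ℝ} (hf : Integrable f μ) (hg : Integrable g μ) :
    Integrable (fun x => f x + g x) μ := hf.add hg

lemma isub {μ : Measure Ω} {f g : Ω → ℝ} (hf : Integrable f μ) (hg : Integrable g μ) :
    Integrable (fun x => f x - g x) μ := hf.sub hg

/-- indicator of a negative majority -/
noncomputable def indLt (x : ℤ × ℤ) : ℝ := if x.1 < 0 then 1 else 0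
/-- indicator of a tie -/
noncomputable def indEq (x : ℤ × ℤ) : ℝ := if x.1 = 0 then 1 else 0
/-- indicator of a nonpositive majority -/
noncomputable def indLe (x : ℤ × ℤ) : ℝ := if x.1 ≤ 0 then 1 else 0

lemma bdd (k : ℕ) (ω : Ω) : P.Δ (k+1) ω ∈ Set.Icc ((-(2*k+1 : ℤ), -(2*k+1 : ℤ)) : ℤ × ℤ) ((2*k+1 : ℤ), (2*k+1 : ℤ)) := by
  induction k with
  | zero => rw [P.init]; simp
  | succ k ih =>
    have h := P.D_range (k+1) (by omega) ω
    have e : P.Δ (k+1+1) ω = P.Δ (k+1) ω + (P.Δ (k+1+1) ω - P.Δ (k+1) ω) := by abel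
    simp only [Set.mem_Icc, Prod.le_def] at ih ⊢
    rw [e]
    simp only [Set.mem_insert_iff, Set.mem_singleton_iff] at h
    push_cast
    rcases h with h | h | h | h <;> rw [h] <;> simp only [Prod.fst_add, Prod.snd_add] <;> omega

lemma gbound (k : ℕ) (g : ℤ × ℤ → ℝ) : ∃ C, ∀ ω, ‖g (P.Δ (k+1) ω)‖ ≤ C := by
  obtain ⟨C, hC⟩ := ((Set.finite_Icc ((-(2*k+1 : ℤ), -(2*k+1 : ℤ)) : ℤ × ℤ) ((2*k+1 : ℤ), (2*k+1 : ℤ))).image (fun x => ‖g x‖)).bddAbove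
  exact ⟨C, fun ω => hC ⟨_, bdd P k ω, rfl⟩⟩

lemma gmeas (k : ℕ) (g : ℤ × ℤ → ℝ) : Measurable[P.F (k+1)] (fun ω => g (P.Δ (k+1) ω)) :=
  (measurable_of_countable g).comp (P.adapted (k+1) (by omega))

lemma gint (k : ℕ) (g : ℤ × ℤ → ℝ) : Integrable (fun ω => g (P.Δ (k+1) ω)) P.μ := by
  have := P.isProb
  obtain ⟨C, hC⟩ := gbound P k g
  exact Integrable.of_bound (((gmeas P k g).mono (P.F_le _) le_rfl).aestronglyMeasurable) C (ae_of_all _ hC)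

lemma condStep (k : ℕ) (d : ℤ × ℤ) (g r : ℤ × ℤ → ℝ)
    (h : P.μ[Set.indicator {ω | P.Δ (k+1+1) ω - P.Δ (k+1) ω = d} (fun _ => (1 : ℝ)) | P.F (k+1)]
      =ᵐ[P.μ] fun ω => r (P.Δ (k+1) ω)) :
    Integrable (fun ω => g (P.Δ (k+1) ω) * Set.indicator {ω | P.Δ (k+1+1) ω - P.Δ (k+1) ω = d} (fun _ => (1 : ℝ)) ω) P.μ ∧
    ∫ ω, g (P.Δ (k+1) ω) * Set.indicator {ω | P.Δ (k+1+1) ω - P.Δ (k+1) ω = d} (fun _ => (1 : ℝ)) ω ∂P.μ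
      = ∫ ω, g (P.Δ (k+1) ω) * r (P.Δ (k+1) ω) ∂P.μ := by
  have := P.isProb
  obtain ⟨C, hC⟩ := gbound P k g
  have hm : MeasurableSet {ω | P.Δ (k+1+1) ω - P.Δ (k+1) ω = d} :=
    ((P.D_meas (k+1) (by omega)).mono (P.F_le _) le_rfl) (measurableSet_singleton d)
  have hi : Integrable (Set.indicator {ω | P.Δ (k+1+1) ω - P.Δ (k+1) ω = d} (fun _ => (1 : ℝ))) P.μ :=
    (integrable_const (1:ℝ)).indicator hm
  have hgi := hi.bdd_mul (((gmeas P k g).mono (P.F_le _) le_rfl).aestronglyMeasurable) (ae_of_all _ hC)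
  refine ⟨hgi, ?_⟩
  rw [← integral_condExp (P.F_le (k+1))]
  apply integral_congr_ae
  have := condExp_mul_of_stronglyMeasurable_left (m := P.F (k+1)) (μ := P.μ) (gmeas P k g).stronglyMeasurable hgi hi
  filter_upwards [this, h] with ω h1 h2
  refine h1.trans ?_
  simp [h2]

lemma step (k : ℕ) (g : ℤ × ℤ → ℝ) :
    ∫ ω, g (P.Δ (k+1+1) ω) ∂P.μ = ∫ ω,
      (fun x : ℤ × ℤ => g (x + (1,2)) * (pse α (k+1) x.1 x.2 * (1-q)) + g (x + (-1,0)) * (pse α (k+1) x.1 x.2 * q)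
       + g (x + (1,0)) * ((1 - pse α (k+1) x.1 x.2) * q) + g (x + (-1,-2)) * ((1 - pse α (k+1) x.1 x.2) * (1-q)))
       (P.Δ (k+1) ω) ∂P.μ := by
  obtain ⟨i1, e1⟩ := condStep P k (1,2) (fun x => g (x + (1,2))) (fun x => pse α (k+1) x.1 x.2 * (1-q)) (P.cond_rr (k+1) (by omega))
  obtain ⟨i2, e2⟩ := condStep P k (-1,0) (fun x => g (x + (-1,0))) (fun x => pse α (k+1) x.1 x.2 * q) (P.cond_br (k+1) (by omega))
  obtain ⟨i3, e3⟩ := condStep P k (1,0) (fun x => g (x + (1,0))) (fun x => (1-pse α (k+1) x.1 x.2) * q) (P.cond_rb (k+1) (by omega))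
  obtain ⟨i4, e4⟩ := condStep P k (-1,-2) (fun x => g (x + (-1,-2))) (fun x => (1-pse α (k+1) x.1 x.2) * (1-q)) (P.cond_bb (k+1) (by omega))
  have j1 := gint P k (fun x => g (x + (1,2)) * (pse α (k+1) x.1 x.2 * (1-q)))
  have j2 := gint P k (fun x => g (x + (-1,0)) * (pse α (k+1) x.1 x.2 * q))
  have j3 := gint P k (fun x => g (x + (1,0)) * ((1-pse α (k+1) x.1 x.2) * q))
  have j4 := gint P k (fun x => g (x + (-1,-2)) * ((1-pse α (k+1) x.1 x.2) * (1-q)))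
  rw [integral_add (iadd (iadd j1 j2) j3) j4, integral_add (iadd j1 j2) j3, integral_add j1 j2,
    ← e1, ← e2, ← e3, ← e4, ← integral_add i1 i2, ← integral_add (iadd i1 i2) i3, ← integral_add (iadd (iadd i1 i2) i3) i4]
  apply integral_congr_ae
  refine ae_of_all _ fun ω => ?_
  have h := P.D_range (k+1) (by omega) ω
  have e : P.Δ (k+1+1) ω = P.Δ (k+1) ω + (P.Δ (k+1+1) ω - P.Δ (k+1) ω) := by abel
  simp only [Set.mem_insert_iff, Set.mem_singleton_iff] at h
  simp only [Set.indicator_apply, Set.mem_setOf_eq]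
  rcases h with h | h | h | h <;> rw [h] <;> rw [h] at e <;> rw [e] <;> simp

/-- total weight at time `k+1` -/
noncomputable def T (α : ℝ) (k : ℕ) : ℝ := 1 + (1+2*α) * k

lemma Z_eq (α : ℝ) (k : ℕ) : Zse α (k+1) * ((k+1 : ℕ) : ℝ) = T α k := by
  unfold Zse T
  have : ((k:ℝ)+1) ≠ 0 := by positivity
  push_cast
  field_simp
  ring

/-- the weight difference -/
def S (α : ℝ) (x : ℤ × ℤ) : ℝ := x.1 + α * x.2
/-- the martingale part -/
def W (α r : ℝ) (x : ℤ × ℤ) : ℝ := x.1 - r * S α x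

lemma T_pos (hβ : 0 < 1 + 2*α) (k : ℕ) : 1 ≤ T α k := by
  unfold T; nlinarith [mul_nonneg hβ.le (Nat.cast_nonneg (α := ℝ) k)]

lemma stepS (k : ℕ) : ∫ ω, S α (P.Δ (k+1+1) ω) ∂P.μ =
    (1 + (1+2*α - 2*q*(1+α)) / T α k) * ∫ ω, S α (P.Δ (k+1) ω) ∂P.μ := by
  rw [step P k (S α), ← integral_const_mul]
  congr 1; ext ω
  simp only [S, pse, Z_eq, Prod.fst_add, Prod.snd_add]
  push_cast
  ring

lemma stepS2 (k : ℕ) : ∫ ω, S α (P.Δ (k+1+1) ω)^2 ∂P.μ =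
    (1 + 2 * (1+2*α - 2*q*(1+α)) / T α k) * (∫ ω, S α (P.Δ (k+1) ω)^2 ∂P.μ) + ((1-q)*(1+2*α)^2 + q) := by
  have := P.isProb
  have i1 := (gint P k (fun x => S α x ^ 2)).const_mul (1 + 2 * (1+2*α - 2*q*(1+α)) / T α k)
  rw [step P k (fun x => S α x ^ 2), ← integral_const_mul]
  have : ((1-q)*(1+2*α)^2 + q) = ∫ ω, ((1-q)*(1+2*α)^2 + q) ∂P.μ := by simp
  rw [this, ← integral_add i1 (integrable_const _)]
  congr 1; ext ω
  simp only [S, pse, Z_eq, Prod.fst_add, Prod.snd_add]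
  push_cast
  ring

lemma stepW2 (r : ℝ) (hr : r * (1+2*α - 2*q*(1+α)) = 1 - 2 * q) (k : ℕ) : ∫ ω, W α r (P.Δ (k+1+1) ω)^2 ∂P.μ =
    (∫ ω, W α r (P.Δ (k+1) ω)^2 ∂P.μ) + (1 - 2 * r * ((1-q)*(1+2*α)+q) + r^2*((1-q)*(1+2*α)^2 + q)) := by
  have := P.isProb
  have i1 := (gint P k (fun x => W α r x ^ 2))
  rw [step P k (fun x => W α r x ^ 2)]
  have : (1 - 2 * r * ((1-q)*(1+2*α)+q) + r^2*((1-q)*(1+2*α)^2 + q)) = ∫ ω, (1 - 2 * r * ((1-q)*(1+2*α)+q) + r^2*((1-q)*(1+2*α)^2 + q)) ∂P.μ := by simp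
  rw [this, ← integral_add i1 (integrable_const _)]
  congr 1; ext ω
  simp only [W, S, pse, Z_eq, Prod.fst_add, Prod.snd_add]
  push_cast
  generalize ((P.Δ (k+1) ω).1 : ℝ) = x
  generalize ((P.Δ (k+1) ω).2 : ℝ) = y
  generalize T α k = t
  linear_combination (-2 * (x - r*(x+α*y)) * (x + α * y) / t) * hr

end SEP
namespace SEP

/-- deterministic recursion -/
lemma m_lower (α κ : ℝ) (hβ : 0 < 1+2*α) (hκ : 0 ≤ κ) (m : ℕ → ℝ) (h0 : m 0 = 1)
    (hm : ∀ k, m (k+1) = (1 + κ / T α k) * m k) (θ : ℝ) (hθ0 : 0 ≤ θ) (hθ1 : θ ≤ 1) (hθ : θ * (1+2*α) ≤ κ) (k : ℕ) :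
    T α k ^ θ ≤ m k := by
  induction k with
  | zero => simp [T, h0]
  | succ k ih =>
    have hT := T_pos hβ k
    have hT' : 0 < T α k := by linarith
    have e : T α (k+1) = (1 + (1+2*α) / T α k) * T α k := by
      field_simp
      unfold T; push_cast; ring
    rw [e, Real.mul_rpow (by positivity) hT'.le, hm]
    have b := rpow_one_add_le_one_add_mul_self (s := (1+2*α) / T α k) (by have : 0 ≤ (1+2*α)/T α k := by positivity
                                                                          linarith) hθ0 hθ1
    gcongr
    refine b.trans ?_
    rw [← mul_div_assoc]
    gcongr

/-- variance proxy -/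
lemma R_bound (α : ℝ) (hβ : 0 < 1+2*α) (h1α : 0 < 1 + α) : ∃ C : ℝ, 0 < C ∧ ∀ q κ : ℝ, 0 ≤ q →
    κ = 1+2*α - 2*q*(1+α) → 3/4 * (1+2*α) ≤ κ → ∀ m M : ℕ → ℝ, m 0 = 1 → M 0 = 1 →
    (∀ k, m (k+1) = (1 + κ / T α k) * m k) →
    (∀ k, M (k+1) = (1 + 2 * κ / T α k) * M k + ((1-q)*(1+2*α)^2 + q)) →
    (∀ k, m k ^ 2 ≤ M k) → ∀ k, M k / m k ^ 2 - 1 ≤ C * q := by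
  set β := 1+2*α with hβd
  set C1 := 1 + 20 * β * (1+α) with hC1
  set c0 := min 1 β with hc0
  have hc0p : 0 < c0 := lt_min one_pos hβ
  have hsum : Summable (fun k : ℕ => (((k+1 : ℕ) : ℝ)) ^ (-(5/4) : ℝ)) :=
    (summable_nat_add_iff 1 (f := fun k : ℕ => ((k : ℕ) : ℝ) ^ (-(5/4) : ℝ))).2 (Real.summable_nat_rpow.2 (by norm_num))
  set A := ∑' k : ℕ, (((k+1 : ℕ) : ℝ)) ^ (-(5/4) : ℝ) with hA
  have hA0 : 0 ≤ A := tsum_nonneg fun k => by positivity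
  have hC1p : 0 < C1 := by positivity
  refine ⟨C1 * c0 ^ (-(5/4) : ℝ) * A + 1, by positivity, ?_⟩
  intro q κ hq hκ hκ2 m M m0 M0 hm hM hmM
  have hκp : 0 < κ := by nlinarith
  have hmpos : ∀ k, 0 < m k := by
    intro k
    induction k with
    | zero => simp [m0]
    | succ k ih =>
      rw [hm]
      have := T_pos hβ k
      have : 0 < T α k := by linarith
      positivity
  have hδ : 0 ≤ q * (1+α) := by positivity
  have hinc : ∀ k, M (k+1) / m (k+1) ^ 2 - 1 ≤ (M k / m k ^ 2 - 1) + C1 * c0 ^ (-(5/4) : ℝ) * q * ((k+1 : ℕ) : ℝ) ^ (-(5/4) : ℝ) := by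
    intro k
    have hT1 := T_pos hβ k
    have hT : 0 < T α k := by linarith
    have hmk := hmpos k
    have hmk1 := hmpos (k+1)
    set t := T α k with ht
    have hlow := m_lower α κ hβ hκp.le m m0 hm (κ/β) (by positivity)
      (by rw [div_le_one hβ]; linarith) (by rw [← hβd]; field_simp; rfl) k
    have hlow2 := m_lower α κ hβ hκp.le m m0 hm (3/4) (by norm_num) (by norm_num) hκ2 (k+1)
    -- u lower bound
    have hlog : Real.log t ≤ 4 * t ^ (1/4 : ℝ) := by
      have := Real.log_le_rpow_div hT.le (ε := 1/4) (by norm_num)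
      linarith
    have hL0 : 0 ≤ Real.log t := Real.log_nonneg hT1
    have ht4 : 1 ≤ t ^ (1/4 : ℝ) := Real.one_le_rpow hT1 (by norm_num)
    have hu : 1 - (2*q*(1+α)/β) * Real.log t ≤ m k / t := by
      have : t ^ (κ/β - 1) ≤ m k / t := by
        rw [Real.rpow_sub_one hT.ne']
        gcongr
      refine le_trans ?_ this
      rw [Real.rpow_def_of_pos hT]
      have := Real.add_one_le_exp (Real.log t * (κ/β - 1))
      refine le_trans (le_of_eq ?_) this
      rw [hκ]; field_simp; ring
    have hz : β - 2*q*(1+α) * (1 + Real.log t) ≤ κ * (m k / t) := by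
      have h1 : κ * (1 - (2*q*(1+α)/β) * Real.log t) ≤ κ * (m k / t) := by gcongr
      have h2 : κ * ((2*q*(1+α)/β) * Real.log t) ≤ β * ((2*q*(1+α)/β) * Real.log t) := by
        apply mul_le_mul_of_nonneg_right
        · linarith
        · have : 0 ≤ (2*q*(1+α)/β) := by positivity
          positivity
      have h3 : β * ((2*q*(1+α)/β) * Real.log t) = 2*q*(1+α)*Real.log t := by field_simp
      linarith
    set z := κ * (m k / t) with hzd
    have hz2 : ((1-q)*β^2 + q) - z^2 ≤ C1 * q * t ^ (1/4 : ℝ) := by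
      have h1 : z^2 ≥ β^2 - 2*β*(2*q*(1+α) * (1 + Real.log t)) := by nlinarith [sq_nonneg (z-β)]
      have h2 : 2*β*(2*q*(1+α) * (1 + Real.log t)) ≤ 2*β*(2*q*(1+α) * (5 * t ^ (1/4 : ℝ))) := by
        gcongr; linarith
      have h3 : q ≤ q * t ^ (1/4 : ℝ) := le_mul_of_one_le_right hq ht4
      have h4 : 0 ≤ q * β^2 := by positivity
      rw [hC1]
      nlinarith
    have hm2 : t ^ (3/2 : ℝ) ≤ m (k+1) ^ 2 := by
      have h1 : t ≤ T α (k+1) := by rw [ht]; unfold T; push_cast; linarith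
      have h2 : t ^ (3/4 : ℝ) ≤ m (k+1) := le_trans (by gcongr) hlow2
      calc t ^ (3/2 : ℝ) = (t ^ (3/4 : ℝ)) ^ 2 := by
            rw [← Real.rpow_natCast, ← Real.rpow_mul hT.le]; norm_num
        _ ≤ _ := by gcongr
    have hkey : M (k+1) / m (k+1) ^ 2 - 1 ≤ (M k / m k ^ 2 - 1) + (((1-q)*β^2 + q) - z^2) / m (k+1)^2 := by
      have h1 : M k / m k ^ 2 ≥ 1 := by
        rw [ge_iff_le, one_le_div (by positivity)]; exact hmM k
      have h2 : (M k / m k ^ 2) * z^2 ≥ z^2 := le_mul_of_one_le_left (sq_nonneg _) h1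
      have h3 : M (k+1) = (M k / m k ^ 2) * m (k+1)^2 - (M k / m k ^ 2) * z^2 + ((1-q)*β^2 + q) := by
        rw [hM, hm, hzd, ← ht]; field_simp; ring
      have h4 : M (k+1) ≤ (M k / m k ^ 2) * m (k+1)^2 + (((1-q)*β^2 + q) - z^2) := by linarith
      have h5 : M (k+1) / m (k+1)^2 ≤ ((M k / m k ^ 2) * m (k+1)^2 + (((1-q)*β^2 + q) - z^2)) / m (k+1)^2 := by gcongr
      rw [add_div, mul_div_cancel_right₀ _ (by positivity)] at h5
      linarith
    refine hkey.trans ?_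
    gcongr
    calc (((1-q)*β^2 + q) - z^2) / m (k+1)^2 ≤ (C1 * q * t ^ (1/4 : ℝ)) / m (k+1)^2 := by gcongr
      _ ≤ (C1 * q * t ^ (1/4 : ℝ)) / t ^ (3/2 : ℝ) := by gcongr
      _ = C1 * q * t ^ (-(5/4) : ℝ) := by
        rw [mul_div_assoc, ← Real.rpow_sub hT]; norm_num
      _ ≤ C1 * q * (c0 * ((k+1 : ℕ) : ℝ)) ^ (-(5/4) : ℝ) := by
        apply mul_le_mul_of_nonneg_left _ (by positivity)
        apply Real.rpow_le_rpow_of_nonpos (by positivity) _ (by norm_num)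
        have h1 : c0 ≤ 1 := min_le_left _ _
        have h2 : c0 * k ≤ β * k := by gcongr; exact min_le_right _ _
        rw [ht]; unfold T; push_cast; linarith
      _ = _ := by
        rw [Real.mul_rpow hc0p.le (by positivity)]; ring
  have hps : ∀ k, M k / m k ^ 2 - 1 ≤ ∑ i ∈ Finset.range k, C1 * c0 ^ (-(5/4) : ℝ) * q * ((i+1 : ℕ) : ℝ) ^ (-(5/4) : ℝ) := by
    intro k
    induction k with
    | zero => simp [m0, M0]
    | succ k ih => rw [Finset.sum_range_succ]; linarith [hinc k]
  intro k
  refine (hps k).trans ?_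
  rw [← Finset.mul_sum]
  have : ∑ i ∈ Finset.range k, ((i+1 : ℕ) : ℝ) ^ (-(5/4) : ℝ) ≤ A := hsum.sum_le_tsum _ (fun i _ => by positivity)
  have h2 : C1 * c0 ^ (-(5/4) : ℝ) * q * ∑ i ∈ Finset.range k, ((i+1 : ℕ) : ℝ) ^ (-(5/4) : ℝ) ≤ C1 * c0 ^ (-(5/4) : ℝ) * q * A := by
    gcongr
  nlinarith

end SEP
namespace SEP
variable {α q : ℝ} {Ω : Type} [mΩ : MeasurableSpace Ω] (P : SEProcess α q Ω)

lemma err_le_one (N : ℕ) : (P.μ {ω | (P.Δ (N+1) ω).1 < 0}).toReal +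
    (1 / 2) * (P.μ {ω | (P.Δ (N+1) ω).1 = 0}).toReal
    ≤ ∫ ω, indLe (P.Δ (N+1) ω) ∂P.μ := by
  have := P.isProb
  have hΔ : Measurable (P.Δ (N+1)) := (P.adapted (N+1) (by omega)).mono (P.F_le _) le_rfl
  have h1 : MeasurableSet {ω | (P.Δ (N+1) ω).1 < 0} :=
    hΔ (Set.to_countable {x : ℤ × ℤ | x.1 < 0}).measurableSet
  have h2 : MeasurableSet {ω | (P.Δ (N+1) ω).1 = 0} :=
    hΔ (Set.to_countable {x : ℤ × ℤ | x.1 = 0}).measurableSet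
  have e1 : (P.μ {ω | (P.Δ (N+1) ω).1 < 0}).toReal = ∫ ω, indLt (P.Δ (N+1) ω) ∂P.μ := by
    rw [← measureReal_def, ← integral_indicator_one h1]
    congr 1; ext ω; simp [indLt, Set.indicator_apply]
  have e2 : (P.μ {ω | (P.Δ (N+1) ω).1 = 0}).toReal = ∫ ω, indEq (P.Δ (N+1) ω) ∂P.μ := by
    rw [← measureReal_def, ← integral_indicator_one h2]
    congr 1; ext ω; simp [indEq, Set.indicator_apply]
  rw [e1, e2, ← integral_const_mul, ← integral_add (gint P N indLt) ((gint P N indEq).const_mul _)]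
  refine integral_mono (iadd (gint P N indLt) ((gint P N indEq).const_mul _)) (gint P N indLe) fun ω => ?_
  dsimp only [indLt, indEq, indLe]
  rcases lt_trichotomy (P.Δ (N+1) ω).1 0 with h | h | h
  · simp [h, h.le, h.ne]
  · simp [h]; norm_num
  · simp [h.not_gt, h.not_ge, h.ne']

lemma chebyshev (k : ℕ) (r m : ℝ) (hr : 0 < r) (hm : 0 < m) (hm' : ∫ ω, S α (P.Δ (k+1) ω) ∂P.μ = m) :
    ∫ ω, indLe (P.Δ (k+1) ω) ∂P.μ ≤
    2 * ((∫ ω, S α (P.Δ (k+1) ω)^2 ∂P.μ) / m^2 - 1) + 2 * (∫ ω, W α r (P.Δ (k+1) ω)^2 ∂P.μ) / (r*m)^2 := by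
  have := P.isProb
  have i1 := gint P k (fun x => S α x)
  have i2 := gint P k (fun x => S α x ^ 2)
  have i3 := gint P k (fun x => W α r x ^ 2)
  have e : ∫ ω, (((2/m^2) * S α (P.Δ (k+1) ω)^2 - (4/m) * S α (P.Δ (k+1) ω) + (2/(r*m)^2) * W α r (P.Δ (k+1) ω)^2) + 2) ∂P.μ =
     2 * ((∫ ω, S α (P.Δ (k+1) ω)^2 ∂P.μ) / m^2 - 1) + 2 * (∫ ω, W α r (P.Δ (k+1) ω)^2 ∂P.μ) / (r*m)^2 := by
    rw [integral_add (iadd (isub (i2.const_mul _) (i1.const_mul _)) (i3.const_mul _)) (integrable_const _),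
      integral_add (isub (i2.const_mul _) (i1.const_mul _)) (i3.const_mul _),
      integral_sub (i2.const_mul _) (i1.const_mul _), integral_const_mul, integral_const_mul, integral_const_mul, hm']
    simp
    field_simp
    ring
  rw [← e]
  refine integral_mono (gint P k indLe) (iadd (iadd (isub (i2.const_mul _) (i1.const_mul _)) (i3.const_mul _)) (integrable_const _)) fun ω => ?_
  dsimp only [indLt, indEq, indLe]
  generalize hx : P.Δ (k+1) ω = x
  have hid : (2/m^2) * S α x^2 - (4/m) * S α x + (2/(r*m)^2) * W α r x^2 + 2 =
     2 * ((S α x - m)/m)^2 + 2 * (W α r x / (r*m))^2 := by field_simp; ring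
  rw [hid]
  split_ifs with h
  · have hx1 : (x.1 : ℝ) ≤ 0 := by exact_mod_cast h
    have h1 : (S α x - m)/m + W α r x / (r*m) ≤ -1 := by
      have : (S α x - m)/m + W α r x / (r*m) = -1 + x.1 / (r*m) := by
        unfold W; field_simp; ring
      rw [this]
      have := div_nonpos_of_nonpos_of_nonneg hx1 (mul_pos hr hm).le
      linarith
    nlinarith [sq_nonneg ((S α x - m)/m - W α r x / (r*m))]
  · positivity

end SEP
open SEP

/-- For every allowed `α` there is `c_α > 0` such that, for every `q ∈ [0,1]` and every shape
exchangeable color-difference process with parameters `(α, q)`, the limsup of the error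
probability `μ(Δ₁(N) < 0) + (1/2)μ(Δ₁(N) = 0)` of the majority estimator is at most
`c_α √q`. -/
theorem se_majority_bound (α : ℝ) (hα : α ∈ seAllowed) :
    ∃ c : ℝ, 0 < c ∧
      ∀ q : ℝ, 0 ≤ q → q ≤ 1 →
        ∀ (Ω : Type) [MeasurableSpace Ω] (P : SEProcess α q Ω),
          Filter.limsup (fun N : ℕ =>
              (P.μ {ω | (P.Δ N ω).1 < 0}).toReal +
                (1 / 2) * (P.μ {ω | (P.Δ N ω).1 = 0}).toReal)
            Filter.atTop ≤ c * Real.sqrt q := by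
  have hβ : 0 < 1 + 2*α := by
    rcases hα with ⟨d, hd, rfl⟩ | h
    · have h3 : (3:ℝ) ≤ d := by exact_mod_cast hd
      have : -1/3 ≤ -1 / (d:ℝ) := by
        rw [neg_div, neg_div, neg_le_neg_iff]
        gcongr
      linarith
    · have : 0 ≤ α := h
      linarith
  have h1α : 0 < 1 + α := by linarith
  obtain ⟨C, hC, hR⟩ := R_bound α hβ h1α
  set q0 := min (1/4) ((1+2*α)/(8*(1+α))) with hq0
  have hq0p : 0 < q0 := lt_min (by norm_num) (by positivity)
  refine ⟨2*C + 1/Real.sqrt q0, by positivity, ?_⟩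
  intro q hq hq1 Ω _ P
  have hprob := P.isProb
  set u := (fun N : ℕ => (P.μ {ω | (P.Δ N ω).1 < 0}).toReal + (1 / 2) * (P.μ {ω | (P.Δ N ω).1 = 0}).toReal) with hu
  have hu0 : ∀ N, 0 ≤ u N := fun N => by positivity
  rw [← limsup_nat_add u 1]
  have hcob : IsCoboundedUnder (· ≤ ·) atTop (fun N => u (N+1)) :=
    isCoboundedUnder_le_of_le atTop (fun N => hu0 (N+1))
  have hsq := Real.sqrt_nonneg q
  by_cases hqq : q ≤ q0
  · have hq4 : q ≤ 1/4 := hqq.trans (min_le_left _ _)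
    have hqb : q * (8*(1+α)) ≤ 1+2*α := by
      rw [← le_div_iff₀ (by positivity)]; exact hqq.trans (min_le_right _ _)
    set κ := 1+2*α - 2*q*(1+α) with hκ
    have hκ2 : 3/4 * (1+2*α) ≤ κ := by linarith
    have hκp : 0 < κ := by nlinarith
    set r := (1-2*q)/κ with hr
    have hrp : 0 < r := div_pos (by linarith) hκp
    have hrκ : r * κ = 1-2*q := by rw [hr]; field_simp
    set m : ℕ → ℝ := fun k => ∫ ω, S α (P.Δ (k+1) ω) ∂P.μ with hm
    set M : ℕ → ℝ := fun k => ∫ ω, S α (P.Δ (k+1) ω)^2 ∂P.μ with hM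
    set w : ℕ → ℝ := fun k => ∫ ω, W α r (P.Δ (k+1) ω)^2 ∂P.μ with hw
    have m0 : m 0 = 1 := by simp [hm, P.init, S]
    have M0 : M 0 = 1 := by simp [hM, P.init, S]
    have ms : ∀ k, m (k+1) = (1 + κ / T α k) * m k := fun k => stepS P k
    have Ms : ∀ k, M (k+1) = (1 + 2 * κ / T α k) * M k + ((1-q)*(1+2*α)^2 + q) := fun k => stepS2 P k
    have hmM : ∀ k, m k ^ 2 ≤ M k := by
      intro k
      have i1 := gint P k (fun x => S α x)
      have i2 := gint P k (fun x => S α x ^ 2)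
      have h : 0 ≤ ∫ ω, (S α (P.Δ (k+1) ω)^2 - (2 * m k) * S α (P.Δ (k+1) ω) + m k ^ 2) ∂P.μ :=
        integral_nonneg fun ω => by
          dsimp only [Pi.zero_apply]
          nlinarith [sq_nonneg (S α (P.Δ (k+1) ω) - m k)]
      rw [integral_add (isub i2 (i1.const_mul _)) (integrable_const _), integral_sub i2 (i1.const_mul _), integral_const_mul] at h
      simp only [integral_const, probReal_univ, one_smul] at h
      change 0 ≤ M k - 2 * m k * m k + m k ^ 2 at h
      linarith
    have hRk := hR q κ hq hκ hκ2 m M m0 M0 ms Ms hmM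
    have hml := m_lower α κ hβ hκp.le m m0 ms (3/4) (by norm_num) (by norm_num) hκ2
    set K := (1 - 2 * r * ((1-q)*(1+2*α)+q) + r^2*((1-q)*(1+2*α)^2 + q)) with hK
    have ws : ∀ k, w (k+1) = w k + K := fun k => stepW2 P r hrκ k
    have wk : ∀ k : ℕ, w k = w 0 + k * K := by
      intro k
      induction k with
      | zero => simp
      | succ k ih => rw [ws, ih]; push_cast; ring
    set B := |w 0| + |K| / (1+2*α) with hB
    have hB0 : 0 ≤ B := by positivity
    have wB : ∀ k, w k ≤ B * T α k := by
      intro k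
      have hT1 := T_pos hβ k
      have h1 : w 0 ≤ |w 0| * T α k := (le_abs_self _).trans (le_mul_of_one_le_right (abs_nonneg _) hT1)
      have h2 : k * K ≤ |K| / (1+2*α) * T α k := by
        have h3 : (k:ℝ) * K ≤ k * |K| := by gcongr; exact le_abs_self _
        have h4 : |K| / (1+2*α) * T α k = |K| / (1+2*α) + k * |K| := by unfold T; field_simp
        have h5 : 0 ≤ |K| / (1+2*α) := by positivity
        linarith
      rw [wk, hB, add_mul]; linarith
    have hbound : ∀ k, u (k+1) ≤ 2 * (C*q) + 2 * B / r^2 * T α k ^ (-(1/2) : ℝ) := by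
      intro k
      have hT1 := T_pos hβ k
      have hT : 0 < T α k := by linarith
      have hmk : 0 < m k := lt_of_lt_of_le (by positivity) (hml k)
      refine (err_le_one P k).trans ((chebyshev P k r (m k) hrp hmk rfl).trans ?_)
      have h1 := hRk k
      change 2 * (M k / m k ^ 2 - 1) + 2 * w k / (r * m k)^2 ≤ _
      have h2 : 2 * w k / (r * m k)^2 ≤ 2 * B / r^2 * T α k ^ (-(1/2) : ℝ) := by
        have h3 : T α k ^ (3/2 : ℝ) ≤ m k ^ 2 := by
          calc T α k ^ (3/2 : ℝ) = (T α k ^ (3/4 : ℝ)) ^ 2 := by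
                rw [← Real.rpow_natCast, ← Real.rpow_mul hT.le]; norm_num
            _ ≤ _ := by gcongr; exact hml k
        calc 2 * w k / (r * m k)^2 ≤ 2 * (B * T α k) / (r * m k)^2 := by gcongr; exact wB k
          _ = 2 * (B * T α k) / (r^2 * m k^2) := by rw [mul_pow]
          _ ≤ 2 * (B * T α k) / (r^2 * T α k ^ (3/2 : ℝ)) := by gcongr
          _ = 2 * B / r^2 * (T α k ^ (1:ℝ) / T α k ^ (3/2 : ℝ)) := by rw [Real.rpow_one]; field_simp
          _ = _ := by rw [← Real.rpow_sub hT]; norm_num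
      linarith
    have hTt : Tendsto (fun k : ℕ => T α k) atTop atTop := by
      unfold T
      exact tendsto_atTop_add_const_left _ _ (tendsto_natCast_atTop_atTop.const_mul_atTop hβ)
    have hlim : Tendsto (fun k : ℕ => 2 * (C*q) + 2 * B / r^2 * T α k ^ (-(1/2) : ℝ)) atTop (nhds (2*(C*q))) := by
      have := ((tendsto_rpow_neg_atTop (y := 1/2) (by norm_num)).comp hTt).const_mul (2 * B / r^2)
      simpa using this.const_add (2*(C*q))
    have h1 : limsup (fun N => u (N+1)) atTop ≤ 2*(C*q) := by
      rw [← hlim.limsup_eq]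
      exact limsup_le_limsup (Eventually.of_forall hbound) hcob hlim.isBoundedUnder_le
    refine h1.trans ?_
    have h2 : q ≤ Real.sqrt q := Real.le_sqrt_of_sq_le (by nlinarith)
    have h3 : 0 ≤ 1 / Real.sqrt q0 * Real.sqrt q := by positivity
    nlinarith
  · have h1 : limsup (fun N => u (N+1)) atTop ≤ 1 := by
      refine limsup_le_of_le hcob (Eventually.of_forall fun N => ?_)
      refine (err_le_one P N).trans ?_
      have : ∫ ω, (1:ℝ) ∂P.μ = 1 := by simp
      refine le_trans ?_ this.le
      refine integral_mono (gint P N indLe) (integrable_const _) fun ω => ?_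
      dsimp only [indLe]
      split_ifs <;> norm_num
    refine h1.trans ?_
    have h2 : 1 ≤ 1 / Real.sqrt q0 * Real.sqrt q := by
      rw [one_div, inv_mul_eq_div, one_le_div (by positivity)]
      exact Real.sqrt_le_sqrt (not_le.1 hqq).le
    have : 0 ≤ 2 * C * Real.sqrt q := by positivity
    linarith
end

section
/- Let α ∈ {−1/d : d ∈ ℕ, d ≥ 3} ∪ [0,∞). For every γ ∈ (0, 1/2) there exist constants B > 1 and q₀ ∈ (0,1), depending only on α and γ, such that for every q ∈ (0, q₀) and every shape exchangeable color-difference process (Δ(n))_{n≥1} with parameters (α, q): A := q^{γ − 1/2} satisfies A > B, and setting Y(n) := n/(Δ₁(n) + α·Δ₂(n))², for every n ≥ 1 the inequality E[ Y(n+1) | ℱ(n) ] ≤ Y(n) holds almost surely on the event {τ_high(A) ≤ n} ∩ {n < τ_low(B)}. -/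
open MeasureTheory Filter
open scoped ENat

lemma se_term_bound {X d K : ℝ} (hX : 0 < X) (hd : |d| ≤ K) (hK : 2 * K ≤ X) :
    1 / (X + d) ^ 2 ≤ 1 / X ^ 2 * (1 - 2 * (d / X) + 8 * (d / X) ^ 2) := by
  obtain ⟨h1, h2⟩ := abs_le.mp hd
  set u := d / X with hu
  have hdu : d = u * X := by rw [hu]; field_simp
  have hu1 : -(1/2) ≤ u := by
    rw [hu, le_div_iff₀ hX]; linarith
  have hpos : 0 < 1 + u := by linarith
  have : X + d = X * (1 + u) := by rw [hdu]; ring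
  rw [this, mul_pow, one_div_mul_eq_div, div_le_div_iff₀ (by positivity) (by positivity)]
  have key : 1 ≤ (1 - 2 * u + 8 * u ^ 2) * (1 + u) ^ 2 := by
    have : (1 - 2 * u + 8 * u ^ 2) * (1 + u) ^ 2 - 1 = u ^ 2 * ((2 * u + 1) * (4 * u + 5)) := by ring
    have h3 : 0 ≤ u ^ 2 * ((2 * u + 1) * (4 * u + 5)) := by
      apply mul_nonneg (sq_nonneg _)
      apply mul_nonneg <;> linarith
    linarith
  have hX2 : 0 < X ^ 2 := by positivity
  nlinarith [mul_le_mul_of_nonneg_left key hX2.le]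

lemma se_real_bound {a q X W p n : ℝ} (ha : 1 / 3 ≤ a) (hq : 0 < q) (hq1 : q * (72 * (a + 1)) ≤ 1)
    (hn : 1 ≤ n) (hW : W = a * n - (a - 1)) (hX : 0 < X) (hXa : 2 * (a + 1) ≤ X)
    (hX2 : 100 * (a + 1) ^ 2 * n ≤ X ^ 2) (hp : p = 1 / 2 * (1 + X / W))
    (hp0 : 0 ≤ p) (hp1 : 0 ≤ 1 - p) :
    (n + 1) / (X + a) ^ 2 * (p * (1 - q)) + (n + 1) / (X + -1) ^ 2 * (p * q)
      + (n + 1) / (X + 1) ^ 2 * ((1 - p) * q) + (n + 1) / (X + -a) ^ 2 * ((1 - p) * (1 - q))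
      ≤ n / X ^ 2 := by
  have hq2 : q ≤ 1 := by nlinarith
  have hWn : n / 3 ≤ W := by rw [hW]; nlinarith
  have hWp : 0 < W := by linarith
  have t1 := se_term_bound (d := a) hX (by rw [abs_of_pos (by linarith)]; linarith) hXa
  have t2 := se_term_bound (d := -1) hX (by rw [abs_neg, abs_one]; linarith) hXa
  have t3 := se_term_bound (d := 1) hX (by rw [abs_one]; linarith) hXa
  have t4 := se_term_bound (d := -a) hX (by rw [abs_neg, abs_of_pos (by linarith)]; linarith) hXa
  have w1 : 0 ≤ (n + 1) * (p * (1 - q)) := by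
    apply mul_nonneg (by linarith) (mul_nonneg hp0 (by linarith))
  have w2 : 0 ≤ (n + 1) * (p * q) := by positivity
  have w3 : 0 ≤ (n + 1) * ((1 - p) * q) := by
    apply mul_nonneg (by linarith) (mul_nonneg hp1 (by linarith))
  have w4 : 0 ≤ (n + 1) * ((1 - p) * (1 - q)) := by
    apply mul_nonneg (by linarith) (mul_nonneg hp1 (by linarith))
  have s1 := mul_le_mul_of_nonneg_left t1 w1
  have s2 := mul_le_mul_of_nonneg_left t2 w2
  have s3 := mul_le_mul_of_nonneg_left t3 w3
  have s4 := mul_le_mul_of_nonneg_left t4 w4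
  set M := (1 - q) * a ^ 2 + q with hM
  have hsum : (n + 1) * (p * (1 - q)) * (1 / X ^ 2 * (1 - 2 * (a / X) + 8 * (a / X) ^ 2))
      + (n + 1) * (p * q) * (1 / X ^ 2 * (1 - 2 * (-1 / X) + 8 * (-1 / X) ^ 2))
      + (n + 1) * ((1 - p) * q) * (1 / X ^ 2 * (1 - 2 * (1 / X) + 8 * (1 / X) ^ 2))
      + (n + 1) * ((1 - p) * (1 - q)) * (1 / X ^ 2 * (1 - 2 * (-a / X) + 8 * (-a / X) ^ 2))
      = 1 / X ^ 2 * ((n + 1) * (1 - 2 * ((a - q * (a + 1)) / W) + 8 * (M / X ^ 2))) := by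
    rw [hM, hp]; field_simp; ring
  have hMX : (n + 1) * (8 * (M / X ^ 2)) ≤ 1 / 6 := by
    have : (n + 1) * (8 * (M / X ^ 2)) = (n + 1) * (8 * M) / X ^ 2 := by ring
    rw [this, div_le_iff₀ (by positivity)]
    have hM1 : M ≤ (a + 1) ^ 2 := by
      have e1 : (a + 1) ^ 2 - M = q * a ^ 2 + 2 * a + (1 - q) := by rw [hM]; ring
      have e2 : 0 ≤ q * a ^ 2 := by positivity
      linarith
    have : (n + 1) * (8 * M) ≤ (2 * n) * (8 * (a + 1) ^ 2) := by
      have : 0 ≤ M := by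
        have e2 := mul_nonneg (sub_nonneg.mpr hq2) (sq_nonneg a)
        rw [hM]; linarith
      gcongr
      linarith
    have e3 := mul_nonneg (sq_nonneg (a+1)) (by linarith : 0 ≤ n)
    linarith
  have hqW : 2 * (n + 1) * (q * (a + 1) / W) ≤ 1 / 6 := by
    rw [← mul_div_assoc, div_le_iff₀ hWp]
    have : q * (a + 1) ≤ 1 / 72 := by linarith
    have : 2 * (n + 1) * (q * (a + 1)) ≤ 2 * (2 * n) * (1 / 72) := by
      gcongr; linarith
    linarith
  have haW : 4 / 3 ≤ 2 * (n + 1) * (a / W) := by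
    rw [← mul_div_assoc, le_div_iff₀ hWp, hW]
    have e4 := mul_nonneg (sub_nonneg.mpr ha) (sub_nonneg.mpr hn)
    linarith
  have hfin : (n + 1) * (1 - 2 * ((a - q * (a + 1)) / W) + 8 * (M / X ^ 2)) ≤ n := by
    have : (n + 1) * (1 - 2 * ((a - q * (a + 1)) / W) + 8 * (M / X ^ 2))
      = n + 1 - 2 * (n + 1) * (a / W) + 2 * (n + 1) * (q * (a + 1) / W)
        + (n + 1) * (8 * (M / X ^ 2)) := by ring
    linarith
  have hfin2 := mul_le_mul_of_nonneg_left hfin (by positivity : 0 ≤ 1 / X ^ 2)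
  calc _ = (n + 1) * (p * (1 - q)) * (1 / (X + a) ^ 2) + (n + 1) * (p * q) * (1 / (X + -1) ^ 2)
      + (n + 1) * ((1 - p) * q) * (1 / (X + 1) ^ 2)
      + (n + 1) * ((1 - p) * (1 - q)) * (1 / (X + -a) ^ 2) := by ring
    _ ≤ 1 / X ^ 2 * n := by linarith
    _ = _ := by ring

lemma se_pullout {Ω : Type} [mΩ : MeasurableSpace Ω] {μ : Measure Ω} [IsProbabilityMeasure μ]
    {m : MeasurableSpace Ω} (hm : m ≤ mΩ) {f g w : Ω → ℝ} {S : Set Ω} (hS : MeasurableSet[mΩ] S)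
    (hf : Integrable f μ) (hg : StronglyMeasurable[m] g) (hfg : ∀ ω ∈ S, f ω = g ω)
    (hw : μ[S.indicator (fun _ => (1 : ℝ)) | m] =ᵐ[μ] w) :
    μ[S.indicator f | m] =ᵐ[μ] fun ω => g ω * w ω := by
  have he : S.indicator f = g * S.indicator (fun _ => (1 : ℝ)) := by
    ext ω
    by_cases h : ω ∈ S
    · simp [h, hfg ω h]
    · simp [h]
  have hi : Integrable (g * S.indicator (fun _ => (1 : ℝ))) μ := by
    rw [← he]; exact hf.indicator hS
  have h1 := condExp_mul_of_stronglyMeasurable_left (m := m) (μ := μ) hg hi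
    ((integrable_const (1 : ℝ)).indicator hS)
  rw [he]
  filter_upwards [h1, hw] with ω h2 h3
  rw [h2, Pi.mul_apply, h3]

lemma se_event {α q : ℝ} {Ω : Type} [MeasurableSpace Ω] (P : SEProcess α q Ω) {A B : ℝ}
    (hAB : B < A) {n : ℕ} (hZ : 0 < Zse α n) {ω : Ω}
    (h1 : tauHigh P A ω ≤ (n : ℕ∞)) (h2 : (n : ℕ∞) < tauLow P A B ω) :
    B * Zse α n * Real.sqrt n < ((P.Δ n ω).1 : ℝ) + α * ((P.Δ n ω).2 : ℝ) := by
  rcases h1.lt_or_eq with h | h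
  · by_contra hc
    push Not at hc
    have : tauLow P A B ω ≤ n := sInf_le ⟨n, rfl, h, hc⟩
    exact absurd h2 (not_lt.mpr this)
  · have hne : {N : ℕ∞ | ∃ n : ℕ, N = (n : ℕ∞) ∧ 1 ≤ n ∧
        A * Zse α n * Real.sqrt n < ((P.Δ n ω).1 : ℝ) + α * ((P.Δ n ω).2 : ℝ)}.Nonempty := by
      by_contra hc
      rw [Set.not_nonempty_iff_eq_empty] at hc
      rw [tauHigh, hc, sInf_empty] at h
      exact absurd h (by simp)
    obtain ⟨k, hk, -, hk2⟩ := csInf_mem hne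
    have : n = k := by
      have : (n : ℕ∞) = k := by rw [← h, ← hk]; rfl
      exact_mod_cast this
    subst this
    refine lt_of_le_of_lt ?_ hk2
    gcongr

lemma se_condExp {α q : ℝ} {Ω : Type} [mΩ : MeasurableSpace Ω] (P : SEProcess α q Ω) (n : ℕ)
    (hn : 1 ≤ n) (G : ℤ × ℤ → ℝ) (hG : Integrable (fun ω => G (P.Δ (n + 1) ω)) P.μ) :
    P.μ[fun ω => G (P.Δ (n + 1) ω) | P.F n] =ᵐ[P.μ] fun ω =>
      G (P.Δ n ω + (1, 2)) * (pse α n (P.Δ n ω).1 (P.Δ n ω).2 * (1 - q))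
      + G (P.Δ n ω + (-1, 0)) * (pse α n (P.Δ n ω).1 (P.Δ n ω).2 * q)
      + G (P.Δ n ω + (1, 0)) * ((1 - pse α n (P.Δ n ω).1 (P.Δ n ω).2) * q)
      + G (P.Δ n ω + (-1, -2)) * ((1 - pse α n (P.Δ n ω).1 (P.Δ n ω).2) * (1 - q)) := by
  haveI := P.isProb
  set f : Ω → ℝ := fun ω => G (P.Δ (n + 1) ω) with hf
  have hS : ∀ d : ℤ × ℤ, MeasurableSet[mΩ] {ω | P.Δ (n + 1) ω - P.Δ n ω = d} := fun d =>
    P.F_le (n + 1) _ (P.D_meas n hn (measurableSet_singleton d))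
  have hg : ∀ d : ℤ × ℤ, StronglyMeasurable[P.F n] (fun ω => G (P.Δ n ω + d)) := fun d => by
    have h1 : Measurable (fun x : ℤ × ℤ => G (x + d)) := measurable_of_countable _
    exact (h1.comp (P.adapted n hn)).stronglyMeasurable
  have hfg : ∀ d : ℤ × ℤ, ∀ ω ∈ {ω | P.Δ (n + 1) ω - P.Δ n ω = d}, f ω = G (P.Δ n ω + d) := by
    intro d ω hω
    have : P.Δ (n + 1) ω - P.Δ n ω = d := hω
    rw [← this, hf]; simp
  have e1 := se_pullout (P.F_le n) (hS (1, 2)) hG (hg _) (hfg _) (P.cond_rr n hn)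
  have e2 := se_pullout (P.F_le n) (hS (-1, 0)) hG (hg _) (hfg _) (P.cond_br n hn)
  have e3 := se_pullout (P.F_le n) (hS (1, 0)) hG (hg _) (hfg _) (P.cond_rb n hn)
  have e4 := se_pullout (P.F_le n) (hS (-1, -2)) hG (hg _) (hfg _) (P.cond_bb n hn)
  have hsum : f = {ω | P.Δ (n + 1) ω - P.Δ n ω = (1, 2)}.indicator f
      + {ω | P.Δ (n + 1) ω - P.Δ n ω = (-1, 0)}.indicator f
      + {ω | P.Δ (n + 1) ω - P.Δ n ω = (1, 0)}.indicator f
      + {ω | P.Δ (n + 1) ω - P.Δ n ω = (-1, -2)}.indicator f := by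
    ext ω
    have := P.D_range n hn ω
    simp only [Set.mem_insert_iff, Set.mem_singleton_iff] at this
    rcases this with h | h | h | h <;> simp [Set.indicator, h]
  have i1 := hG.indicator (hS (1, 2))
  have i2 := hG.indicator (hS (-1, 0))
  have i3 := hG.indicator (hS (1, 0))
  have i4 := hG.indicator (hS (-1, -2))
  have a1 := condExp_add i1 i2 (P.F n)
  have a2 := condExp_add (i1.add i2) i3 (P.F n)
  have a3 := condExp_add ((i1.add i2).add i3) i4 (P.F n)
  rw [← hf] at *
  rw [← hsum] at a3
  filter_upwards [a1, a2, a3, e1, e2, e3, e4] with ω b1 b2 b3 c1 c2 c3 c4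
  rw [b3, Pi.add_apply, b2, Pi.add_apply, b1, Pi.add_apply, c1, c2, c3, c4]

/-- Supermartingale property of `Y(n) = n/(Δ₁(n) + αΔ₂(n))²` between the stopping times
`τ_high(A)` and `τ_low(B)` for shape exchangeable trees: for every `γ ∈ (0, 1/2)` there are
`B > 1` and `q₀ ∈ (0,1)` such that for all `q ∈ (0, q₀)`, `A := q^(γ-1/2)` satisfies `A > B`
and `E[Y(n+1) | ℱ(n)] ≤ Y(n)` a.s. on `{τ_high(A) ≤ n} ∩ {n < τ_low(B)}`. -/
theorem se_Y_supermartingale (α : ℝ) (hα : α ∈ seAllowed)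
    (γ : ℝ) (hγ0 : 0 < γ) (hγ : γ < 1 / 2) :
    ∃ B q₀ : ℝ, 1 < B ∧ 0 < q₀ ∧ q₀ < 1 ∧
      ∀ q : ℝ, 0 < q → q < q₀ →
        ∀ (Ω : Type) [MeasurableSpace Ω] (P : SEProcess α q Ω),
          B < q ^ (γ - 1 / 2) ∧
          ∀ n : ℕ, 1 ≤ n →
            ∀ᵐ ω ∂P.μ,
              (tauHigh P (q ^ (γ - 1 / 2)) ω ≤ (n : ℕ∞) ∧
                  (n : ℕ∞) < tauLow P (q ^ (γ - 1 / 2)) B ω) →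
                (P.μ[fun ω' => (((n : ℝ) + 1)) /
                    ((((P.Δ (n + 1) ω').1 : ℝ) + α * ((P.Δ (n + 1) ω').2 : ℝ)) ^ 2)
                  | P.F n]) ω
                  ≤ (n : ℝ) / ((((P.Δ n ω).1 : ℝ) + α * ((P.Δ n ω).2 : ℝ)) ^ 2) := by
  have ha : 1 / 3 ≤ 1 + 2 * α := by
    rcases hα with ⟨d, hd, rfl⟩ | h
    · have hd' : (3 : ℝ) ≤ d := by exact_mod_cast hd
      have : (1 : ℝ) / d ≤ 1 / 3 := one_div_le_one_div_of_le (by norm_num) hd'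
      have h2 : (-1 : ℝ) / d = -(1 / d) := by ring
      rw [h2]; linarith
    · have : 0 ≤ α := h
      linarith
  obtain ⟨a, hadef⟩ : ∃ a, a = 1 + 2 * α := ⟨_, rfl⟩
  rw [← hadef] at ha
  have hB0 : 0 < 30 * (a + 1) := by linarith
  have hc : 0 < 1 / 2 - γ := by linarith
  refine ⟨30 * (a + 1), min ((30 * (a + 1)) ^ (-(1 / (1 / 2 - γ)))) (1 / (72 * (a + 1))),
    by linarith, lt_min (Real.rpow_pos_of_pos hB0 _) (by positivity),
    lt_of_le_of_lt (min_le_right _ _) ?_, ?_⟩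
  · rw [div_lt_one (by linarith)]; linarith
  intro q hq hq0 Ω _ P
  have hAB : 30 * (a + 1) < q ^ (γ - 1 / 2) := by
    have h1 := lt_of_lt_of_le hq0 (min_le_left _ _)
    have h2 := Real.rpow_lt_rpow_of_neg hq h1 (show γ - 1 / 2 < 0 by linarith)
    rwa [← Real.rpow_mul hB0.le,
      show -(1 / (1 / 2 - γ)) * (γ - 1 / 2) = 1 by
        rw [show γ - 1 / 2 = -(1 / 2 - γ) by ring, neg_mul_neg]
        exact one_div_mul_cancel hc.ne', Real.rpow_one] at h2
  have hq1 : q * (72 * (a + 1)) ≤ 1 := by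
    have h1 := lt_of_lt_of_le hq0 (min_le_right _ _)
    rw [lt_div_iff₀ (by linarith)] at h1
    exact h1.le
  refine ⟨hAB, fun n hn => ?_⟩
  haveI := P.isProb
  by_cases hInteg : Integrable (fun ω' => (((n : ℝ) + 1)) /
      ((((P.Δ (n + 1) ω').1 : ℝ) + α * ((P.Δ (n + 1) ω').2 : ℝ)) ^ 2)) P.μ
  swap
  · rw [condExp_of_not_integrable hInteg]
    refine ae_of_all _ fun ω _ => ?_
    simp only [Pi.zero_apply]
    positivity
  have hE := se_condExp P n hn
    (fun x => ((n : ℝ) + 1) / (((x.1 : ℝ) + α * (x.2 : ℝ)) ^ 2)) hInteg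
  have hq2 : q < 1 := by nlinarith
  have hnn : ∀ d : ℤ × ℤ, 0 ≤ᵐ[P.μ]
      P.μ[Set.indicator {ω | P.Δ (n + 1) ω - P.Δ n ω = d} (fun _ => (1 : ℝ)) | P.F n] := fun d =>
    condExp_nonneg (ae_of_all _ fun ω => Set.indicator_nonneg (fun _ _ => zero_le_one) ω)
  filter_upwards [hE, hnn (1, 2), hnn (1, 0), P.cond_rr n hn, P.cond_rb n hn] with
    ω h1 h2 h3 h4 h5 hev
  rw [h1]
  rw [h4] at h2
  rw [h5] at h3
  simp only [Pi.zero_apply] at h2 h3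
  have hp0 := nonneg_of_mul_nonneg_left h2 (by linarith)
  have hp1 := nonneg_of_mul_nonneg_left h3 hq
  have hn' : (1 : ℝ) ≤ n := by exact_mod_cast hn
  have hnp : (0 : ℝ) < n := by linarith
  have hZn : Zse α n * n = a * n - (a - 1) := by
    rw [Zse, hadef]; field_simp; ring
  have hZ3 : 1 / 3 ≤ Zse α n := by
    by_contra hcon
    push Not at hcon
    have := mul_lt_mul_of_pos_right hcon hnp
    rw [hZn] at this
    nlinarith
  have hX := se_event P hAB (by linarith) hev.1 hev.2
  have hs1 : 1 ≤ Real.sqrt n := Real.one_le_sqrt.mpr hn'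
  have hXl : 10 * (a + 1) * Real.sqrt n ≤ ((P.Δ n ω).1 : ℝ) + α * ((P.Δ n ω).2 : ℝ) := by
    refine le_trans ?_ hX.le
    have : 10 * (a + 1) ≤ 30 * (a + 1) * Zse α n := by nlinarith
    gcongr
  have hXl2 : 10 * (a + 1) ≤ 10 * (a + 1) * Real.sqrt n :=
    le_mul_of_one_le_right (by linarith) hs1
  have hX2 : 100 * (a + 1) ^ 2 * n ≤ (((P.Δ n ω).1 : ℝ) + α * ((P.Δ n ω).2 : ℝ)) ^ 2 := by
    have := pow_le_pow_left₀ (by linarith) hXl 2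
    rw [mul_pow, Real.sq_sqrt hnp.le] at this
    linarith
  have := se_real_bound (p := pse α n (P.Δ n ω).1 (P.Δ n ω).2) ha hq hq1 hn' hZn
    (by linarith) (by linarith) hX2 rfl hp0 hp1
  convert this using 1
  simp only [Prod.fst_add, Prod.snd_add, hadef]
  push_cast
  ring_nf
end

section
/- Let α ∈ {−1/d : d ∈ ℕ, d ≥ 3} ∪ [0,∞). There exist constants B > 1 and c_{α,2} > 0, depending only on α, such that for every q ∈ (0,1] and every shape exchangeable color-difference process (Δ(n))_{n≥1} with parameters (α, q), setting A := q^{−1/4}: liminf_{N→∞} μ( {τ_high(A) ≤ N} ∩ {τ_low(B) > N} ) ≥ 1 − c_{α,2}·√q. -/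
open MeasureTheory Filter
open scoped ENat

namespace SEAux

/-- The linear functional `x₁ + α x₂`. -/
noncomputable def xf (α : ℝ) (v : ℤ × ℤ) : ℝ := (v.1 : ℝ) + α * (v.2 : ℝ)

lemma Z_pos {α : ℝ} (hα : -(1/3) ≤ α) {n : ℕ} (hn : 1 ≤ n) : 1/3 ≤ Zse α n := by
  unfold Zse
  have h1 : (1:ℝ) ≤ n := by exact_mod_cast hn
  have h2 : 0 ≤ 1 - 1/(n:ℝ) := by
    rw [sub_nonneg, div_le_one (by linarith)]; exact h1
  have h3 : 1 - 1/(n:ℝ) ≤ 1 := by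
    have : 0 ≤ 1/(n:ℝ) := by positivity
    linarith
  nlinarith

lemma Z_le {α : ℝ} {n : ℕ} (hn : 1 ≤ n) : Zse α n ≤ 1 + 2 * |α| := by
  unfold Zse
  have h1 : (1:ℝ) ≤ n := by exact_mod_cast hn
  have h2 : 0 ≤ 1 - 1/(n:ℝ) := by
    rw [sub_nonneg, div_le_one (by linarith)]; exact h1
  have h3 : 1 - 1/(n:ℝ) ≤ 1 := by
    have : 0 ≤ 1/(n:ℝ) := by positivity
    linarith
  nlinarith [le_abs_self α, abs_nonneg α]

/-- The drift coefficient. -/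
noncomputable def rho (α q : ℝ) (n : ℕ) : ℝ :=
  ((1 + 2 * α) - 2 * q * (1 + α)) / (Zse α n * n)

lemma rho_ge {α q : ℝ} (hα : -(1/3) ≤ α) {n : ℕ} (hn : 10 ≤ n) (hq0 : 0 < q)
    (hq : q ≤ 1/100) : 3 / (4 * n) ≤ rho α q n := by
  have hZ := Z_pos hα (n := n) (by omega)
  have h1 : (10:ℝ) ≤ n := by exact_mod_cast hn
  unfold rho
  have hn0 : (0:ℝ) < n := by linarith
  rw [div_le_div_iff₀ (by positivity) (by positivity)]
  have key : 3 * Zse α n ≤ ((1 + 2 * α) - 2 * q * (1 + α)) * 4 := by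
    unfold Zse
    have hi : 1/(n:ℝ) ≤ 1/10 := by
      apply one_div_le_one_div_of_le <;> linarith
    have hi0 : 0 ≤ 1/(n:ℝ) := by positivity
    generalize 1/(n:ℝ) = t at *
    by_cases h : 0 ≤ α
    · nlinarith [mul_nonneg h hi0]
    · push Not at h
      nlinarith [mul_nonneg (neg_nonneg.2 h.le) (sub_nonneg.2 hi)]
  nlinarith

lemma inv_sq_bound {x d K : ℝ} (hK : 1 ≤ K) (hx : 6 * K ≤ x) (hd : |d| ≤ K) :
    1 / (x + d)^2 ≤ 1/x^2 + 8 * K^2 / x^4 - 2/x^3 * d := by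
  obtain ⟨hd1, hd2⟩ := abs_le.1 hd
  have hx0 : 0 < x := by linarith
  have hxd : 0 < x + d := by linarith
  have e : 1/x^2 + 8 * K^2 / x^4 - 2/x^3 * d = (x^2 + 8 * K^2 - 2 * x * d) / x^4 := by
    field_simp
  rw [e, div_le_div_iff₀ (by positivity) (by positivity)]
  have hd2' : d^2 ≤ K^2 := by nlinarith
  have h1 : x^4 ≤ (x^2 + 8 * d^2 - 2 * x * d) * (x+d)^2 := by
    have : (x^2 + 8 * d^2 - 2 * x * d) * (x+d)^2 - x^4
        = d^2 * (5 * x^2 + 14 * x * d + 8 * d^2) := by ring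
    have h2 : 0 ≤ 5 * x^2 + 14 * x * d + 8 * d^2 := by
      nlinarith [mul_pos hx0 hx0, sq_nonneg d]
    nlinarith [mul_nonneg (sq_nonneg d) h2]
  nlinarith [mul_le_mul_of_nonneg_right hd2' (sq_nonneg (x+d))]

section
variable {α q : ℝ} {Ω : Type} [mΩ : MeasurableSpace Ω] (P : SEProcess α q Ω)

/-- The scalar process. -/
noncomputable def X (n : ℕ) (ω : Ω) : ℝ := xf α (P.Δ n ω)

lemma X_meas (n : ℕ) (hn : 1 ≤ n) (g : ℝ → ℝ) :
    Measurable[P.F n] (fun ω => g (X P n ω)) :=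
  (Measurable.of_discrete (f := fun v : ℤ × ℤ => g (xf α v))).comp (P.adapted n hn)

/-- Indicator of an increment value. -/
noncomputable def ind (n : ℕ) (v : ℤ × ℤ) : Ω → ℝ :=
  Set.indicator {ω | P.Δ (n + 1) ω - P.Δ n ω = v} (fun _ => (1 : ℝ))

lemma ind_int (n : ℕ) (hn : 1 ≤ n) (v : ℤ × ℤ) : Integrable (ind P n v) P.μ := by
  have := P.isProb
  refine (integrable_const (1:ℝ)).indicator ?_
  exact (P.F_le (n+1)) _ (P.D_meas n hn (measurableSet_singleton v))

lemma X_incr (n : ℕ) (hn : 1 ≤ n) (ω : Ω) :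
    X P (n+1) ω - X P n ω =
      (1 + 2 * α) * ind P n (1,2) ω + (-1) * ind P n (-1,0) ω + 1 * ind P n (1,0) ω
        + (-(1 + 2 * α)) * ind P n (-1,-2) ω := by
  have hX : X P (n+1) ω - X P n ω = xf α (P.Δ (n+1) ω - P.Δ n ω) := by
    unfold X xf; simp; ring
  have h := P.D_range n hn ω
  rw [hX]
  simp only [ind, Set.indicator, Set.mem_ofPred_eq]
  simp only [Set.mem_insert_iff, Set.mem_singleton_iff] at h
  rcases h with h | h | h | h <;> rw [h] <;> simp [xf] <;> ring

lemma X_incr_abs (n : ℕ) (hn : 1 ≤ n) (ω : Ω) :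
    |X P (n+1) ω - X P n ω| ≤ 1 + 2 * |α| := by
  have hX : X P (n+1) ω - X P n ω = xf α (P.Δ (n+1) ω - P.Δ n ω) := by
    unfold X xf; simp; ring
  have h := P.D_range n hn ω
  rw [hX]
  simp only [Set.mem_insert_iff, Set.mem_singleton_iff] at h
  have h1 := neg_abs_le α
  have h2 := le_abs_self α
  rcases h with h | h | h | h <;> rw [h] <;> rw [abs_le] <;> constructor <;>
    norm_num [xf] <;> linarith [abs_nonneg α]

lemma pull (n : ℕ) (f g : Ω → ℝ) (hf : Measurable[P.F n] f) (C : ℝ)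
    (hC : ∀ ω, |f ω| ≤ C) (hg : Integrable g P.μ) :
    ∫ ω, f ω * g ω ∂P.μ = ∫ ω, f ω * (P.μ[g | P.F n]) ω ∂P.μ := by
  have := P.isProb
  have hfg : Integrable (f * g) P.μ := by
    refine hg.bdd_mul (c := C) ?_ ?_
    · exact (hf.mono (P.F_le n) le_rfl).aestronglyMeasurable
    · exact Eventually.of_forall hC
  have h := condExp_mul_of_stronglyMeasurable_left (μ := P.μ) (m := P.F n)
    hf.stronglyMeasurable hfg hg
  have h2 := integral_condExp (μ := P.μ) (f := f * g) (P.F_le n)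
  exact h2.symm.trans (integral_congr_ae h)

lemma incr_int (n : ℕ) (hn : 1 ≤ n) : Integrable (fun ω => X P (n+1) ω - X P n ω) P.μ := by
  simp only [X_incr P n hn]
  exact ((((ind_int P n hn _).const_mul _).add ((ind_int P n hn _).const_mul _)).add
    ((ind_int P n hn _).const_mul _)).add ((ind_int P n hn _).const_mul _)

lemma condExp_incr (n : ℕ) (hn : 1 ≤ n) :
    P.μ[fun ω => X P (n+1) ω - X P n ω | P.F n] =ᵐ[P.μ] fun ω => X P n ω * rho α q n := by
  have := P.isProb
  have e : (fun ω => X P (n+1) ω - X P n ω) =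
      (1 + 2 * α) • ind P n (1,2) + (-1 : ℝ) • ind P n (-1,0) + (1:ℝ) • ind P n (1,0)
        + (-(1 + 2 * α)) • ind P n (-1,-2) := by
    funext ω
    rw [X_incr P n hn]; simp
  rw [e]
  have i1 := (ind_int P n hn (1,2)).smul (1 + 2 * α)
  have i2 := (ind_int P n hn (-1,0)).smul (-1 : ℝ)
  have i3 := (ind_int P n hn (1,0)).smul (1 : ℝ)
  have i4 := (ind_int P n hn (-1,-2)).smul (-(1 + 2 * α))
  filter_upwards [condExp_add ((i1.add i2).add i3) i4 (P.F n),
    condExp_add (i1.add i2) i3 (P.F n), condExp_add i1 i2 (P.F n),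
    condExp_smul (μ := P.μ) (1 + 2 * α) (ind P n (1,2)) (P.F n),
    condExp_smul (μ := P.μ) (-1:ℝ) (ind P n (-1,0)) (P.F n),
    condExp_smul (μ := P.μ) (1:ℝ) (ind P n (1,0)) (P.F n),
    condExp_smul (μ := P.μ) (-(1 + 2 * α)) (ind P n (-1,-2)) (P.F n),
    P.cond_rr n hn, P.cond_br n hn, P.cond_rb n hn, P.cond_bb n hn]
    with ω h1 h2 h3 h4 h5 h6 h7 c1 c2 c3 c4
  rw [h1, Pi.add_apply, h2, Pi.add_apply, h3, Pi.add_apply, h4, h5, h6, h7]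
  simp only [Pi.smul_apply, smul_eq_mul]
  unfold ind
  rw [c1, c2, c3, c4]
  unfold pse rho X xf
  ring

lemma pull_incr (n : ℕ) (hn : 1 ≤ n) (f : Ω → ℝ) (hf : Measurable[P.F n] f) (C : ℝ)
    (hC : ∀ ω, |f ω| ≤ C) :
    ∫ ω, f ω * (X P (n+1) ω - X P n ω) ∂P.μ = ∫ ω, f ω * (X P n ω * rho α q n) ∂P.μ := by
  rw [pull P n f _ hf C hC (incr_int P n hn)]
  apply integral_congr_ae
  filter_upwards [condExp_incr P n hn] with ω h
  rw [h]

/-- All increments up to time `n` are `(1,2)`. -/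
def G (n : ℕ) : Set Ω := {ω | ∀ k, 1 ≤ k → k ≤ n → P.Δ k ω = ((k : ℤ), 2 * ((k : ℤ) - 1))}

lemma G_meas (n : ℕ) : MeasurableSet[P.F n] (G P n) := by
  have : G P n = ⋂ k : ℕ, ⋂ (_ : 1 ≤ k), ⋂ (_ : k ≤ n),
      P.Δ k ⁻¹' {((k : ℤ), 2 * ((k : ℤ) - 1))} := by
    ext ω; simp [G]
  rw [this]
  refine MeasurableSet.iInter fun k => MeasurableSet.iInter fun h1 =>
    MeasurableSet.iInter fun h2 => ?_
  exact P.F_mono h2 _ (P.adapted k h1 (measurableSet_singleton _))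

lemma G_X {n k : ℕ} (h1 : 1 ≤ k) (hk : k ≤ n) {ω : Ω} (h : ω ∈ G P n) :
    X P k ω = Zse α k * k := by
  have hk0 : (k:ℝ) ≠ 0 := by positivity
  unfold X xf Zse
  rw [h k h1 hk]
  push_cast
  field_simp
  ring

lemma G_prob (hα : -(1/3) ≤ α) (n : ℕ) : P.μ.real (G P (n+1)) = (1 - q)^n := by
  have := P.isProb
  induction n with
  | zero =>
    have : G P (0+1) = Set.univ := by
      ext ω
      simp only [G, Set.mem_ofPred_eq, Set.mem_univ, iff_true]
      intro k h1 h2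
      obtain rfl : k = 1 := by omega
      rw [P.init]; simp
    rw [this]; simp
  | succ n ih =>
    have hn : 1 ≤ n + 1 := by omega
    have hG := G_meas P (n+1)
    have hG' := P.F_le _ _ hG
    have hp := pull P (n+1) (Set.indicator (G P (n+1)) (fun _ => (1:ℝ))) (ind P (n+1) (1,2))
      (measurable_const.indicator hG) 1
      (fun ω => by unfold Set.indicator; split_ifs <;> simp) (ind_int P (n+1) hn _)
    have e1 : (fun ω => Set.indicator (G P (n+1)) (fun _ => (1:ℝ)) ω * ind P (n+1) (1,2) ω)
        = Set.indicator (G P (n+1+1)) (fun _ => (1:ℝ)) := by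
      funext ω
      have : ω ∈ G P (n+1+1) ↔ ω ∈ G P (n+1) ∧ P.Δ (n+1+1) ω - P.Δ (n+1) ω = (1,2) := by
        constructor
        · intro h
          refine ⟨fun k h1 h2 => h k h1 (by omega), ?_⟩
          rw [h (n+1+1) (by omega) le_rfl, h (n+1) (by omega) (by omega)]
          ext
          · simp
          · simp; ring
        · rintro ⟨h, h'⟩ k h1 h2
          rcases Nat.lt_or_ge (n+1) k with h3 | h3
          · obtain rfl : k = n+1+1 := by omega
            have h4 : P.Δ (n+1+1) ω = (1,2) + P.Δ (n+1) ω := by rw [← h']; abel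
            rw [h4, h (n+1) (by omega) le_rfl]
            ext
            · simp; ring
            · simp; ring
          · exact h k h1 h3
      unfold ind
      by_cases h1 : ω ∈ G P (n+1) <;>
        by_cases h2 : P.Δ (n+1+1) ω - P.Δ (n+1) ω = (1,2) <;>
        simp [Set.indicator, this, h1, h2]
    have e2 : ∫ ω, Set.indicator (G P (n+1)) (fun _ => (1:ℝ)) ω *
        (P.μ[ind P (n+1) (1,2) | P.F (n+1)]) ω ∂P.μ
        = ∫ ω, Set.indicator (G P (n+1)) (fun _ => (1:ℝ)) ω * (1 - q) ∂P.μ := by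
      apply integral_congr_ae
      filter_upwards [P.cond_rr (n+1) hn] with ω h
      unfold ind
      rw [h]
      by_cases h1 : ω ∈ G P (n+1)
      · have hx := G_X P hn le_rfl h1
        have hZ := Z_pos hα hn
        have : pse α (n+1) (P.Δ (n+1) ω).1 (P.Δ (n+1) ω).2 = 1 := by
          unfold X xf at hx
          unfold pse
          rw [hx, div_self (by positivity)]; norm_num
        rw [this]; ring
      · simp [h1]
    rw [e1, e2, integral_indicator_const _ (P.F_le _ _ (G_meas P _)), integral_mul_const,
      integral_indicator_const _ hG', ih] at hp
    simp only [smul_eq_mul, mul_one] at hp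
    rw [hp, pow_succ]

/-- The alive event. -/
def S (b : ℝ) (m n : ℕ) : Set Ω :=
  {ω | ω ∈ G P m ∧ ∀ k, m ≤ k → k ≤ n → b * Real.sqrt k < X P k ω}

lemma S_meas (b : ℝ) (m n : ℕ) (hm : 1 ≤ m) (hmn : m ≤ n) :
    MeasurableSet[P.F n] (S P b m n) := by
  have : S P b m n = G P m ∩ ⋂ k : ℕ, ⋂ (_ : m ≤ k), ⋂ (_ : k ≤ n),
      (X P k) ⁻¹' Set.Ioi (b * Real.sqrt k) := by
    ext ω; simp [S]
  rw [this]
  refine MeasurableSet.inter (P.F_mono hmn _ (G_meas P m)) ?_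
  refine MeasurableSet.iInter fun k => MeasurableSet.iInter fun h1 =>
    MeasurableSet.iInter fun h2 => ?_
  exact P.F_mono h2 _ (X_meas P k (hm.trans h1) id measurableSet_Ioi)

/-- The Lyapunov functional. -/
noncomputable def W (b : ℝ) (m n : ℕ) : Ω → ℝ :=
  Set.indicator (S P b m n) (fun ω => n / (X P n ω)^2 - 1/b^2)

lemma S_X {b : ℝ} {m n : ℕ} (hm : 1 ≤ m) (hmn : m ≤ n) (hb : 1 ≤ b) {ω : Ω}
    (h : ω ∈ S P b m n) : b ≤ X P n ω ∧ b^2 * n ≤ (X P n ω)^2 := by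
  have h1 := h.2 n hmn le_rfl
  have hn : (1:ℝ) ≤ n := by exact_mod_cast hm.trans hmn
  have h2 : 1 ≤ Real.sqrt n := by rw [Real.one_le_sqrt]; exact hn
  have h3 := Real.sq_sqrt (by linarith : (0:ℝ) ≤ n)
  constructor
  · nlinarith
  · rw [← h3, ← mul_pow]
    exact pow_le_pow_left₀ (by positivity) h1.le 2

lemma bdd_ind_int {s : Set Ω} {n : ℕ} (hs : MeasurableSet[P.F n] s) {f : Ω → ℝ}
    (hf : Measurable[P.F n] f) {C : ℝ} (hC : ∀ ω ∈ s, |f ω| ≤ C) :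
    Integrable (s.indicator f) P.μ := by
  have := P.isProb
  refine Integrable.of_bound (C := max C 0)
    ((hf.indicator hs).mono (P.F_le n) le_rfl).aestronglyMeasurable ?_
  refine Eventually.of_forall fun ω => ?_
  by_cases h : ω ∈ s
  · simp only [h, Set.indicator_of_mem, Real.norm_eq_abs]
    exact (hC ω h).trans (le_max_left _ _)
  · simp [h]

lemma W_int {b : ℝ} {m n : ℕ} (hm : 1 ≤ m) (hmn : m ≤ n) (hb : 1 ≤ b) :
    Integrable (W P b m n) P.μ := by
  refine bdd_ind_int P (S_meas P b m n hm hmn)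
    (X_meas P n (hm.trans hmn) (fun x => n / x^2 - 1/b^2)) (C := n + 1) ?_
  intro ω h
  obtain ⟨h1, h2⟩ := S_X P hm hmn hb h
  have a1 : (n:ℝ) / (X P n ω)^2 ≤ n := div_le_self (by positivity) (by nlinarith)
  have a2 : 1 / b^2 ≤ 1 := div_le_self (by positivity) (by nlinarith)
  have a3 : 0 ≤ (n:ℝ) / (X P n ω)^2 := by positivity
  have a4 : 0 ≤ 1 / b^2 := by positivity
  rw [abs_le]; constructor <;> linarith

lemma step_num {x t K ν ρ : ℝ} (hK : 1 ≤ K) (hν : 1 ≤ ν) (hx0 : 0 < x)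
    (hx : 36 * K^2 * ν ≤ x^2) (hρ : 3 / (4 * ν) ≤ ρ) :
    (ν + 1) * (1/x^2 + 8 * K^2 / x^4) - t - (ν+1) * (2/x^3) * (x * ρ) ≤ ν / x^2 - t := by
  have e : (ν + 1) * (1/x^2 + 8 * K^2 / x^4) - (ν+1) * (2/x^3) * (x * ρ)
      = (ν+1) * (1 + 8 * K^2/x^2 - 2 * ρ) / x^2 := by
    field_simp
  have h1 : 8 * K^2/x^2 ≤ 1/(4*ν) := by
    rw [div_le_div_iff₀ (by positivity) (by positivity)]
    nlinarith [mul_nonneg (sq_nonneg K) (by linarith : 0 ≤ ν)]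
  have h2 : (ν+1) * (1 + 8 * K^2/x^2 - 2 * ρ) ≤ ν := by
    have h3 : 1 + 8 * K^2/x^2 - 2 * ρ ≤ 1 - 5/(4*ν) := by
      have : 3/(4*ν) * 2 - 1/(4*ν) = 5/(4*ν) := by ring
      linarith
    have h4 : (ν+1) * (1 - 5/(4*ν)) ≤ ν := by
      have : (ν+1) * (1 - 5/(4*ν)) = ν - 1/4 - 5/(4*ν) := by field_simp; ring
      have : 0 ≤ 5/(4*ν) := by positivity
      linarith
    have := mul_le_mul_of_nonneg_left h3 (by linarith : 0 ≤ ν + 1)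
    linarith
  have h5 : (ν+1) * (1 + 8 * K^2/x^2 - 2 * ρ) / x^2 ≤ ν / x^2 := by gcongr
  linarith

lemma W_step (hα : -(1/3) ≤ α) (hq0 : 0 < q) (hq : q ≤ 1/100) {K : ℝ} (hKd : K = 1 + 2 * |α|)
    {m n : ℕ} (hm : 10 ≤ m) (hmn : m ≤ n) :
    ∫ ω, W P (6*K) m (n+1) ω ∂P.μ ≤ ∫ ω, W P (6*K) m n ω ∂P.μ := by
  have := P.isProb
  have hK : 1 ≤ K := by rw [hKd]; linarith [abs_nonneg α]
  have hn : 1 ≤ n := by omega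
  have hm1 : 1 ≤ m := by omega
  have hb : 1 ≤ 6 * K := by linarith
  have hS := S_meas P (6*K) m n hm1 hmn
  set φ : Ω → ℝ := Set.indicator (S P (6*K) m n)
    (fun ω => ((n:ℝ)+1) * (1/(X P n ω)^2 + 8 * K^2/(X P n ω)^4) - 1/(6*K)^2) with hφ
  set f : Ω → ℝ := Set.indicator (S P (6*K) m n)
    (fun ω => ((n:ℝ)+1) * (2/(X P n ω)^3)) with hf
  have hfm : Measurable[P.F n] f :=
    (X_meas P n hn (fun x => ((n:ℝ)+1) * (2/x^3))).indicator hS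
  have hfb : ∀ ω, |f ω| ≤ ((n:ℝ)+1)*2 := by
    intro ω
    by_cases h : ω ∈ S P (6*K) m n
    · obtain ⟨h1, h2⟩ := S_X P hm1 hmn hb h
      have h3 : 1 ≤ X P n ω := by linarith
      have h4 : (0:ℝ) < X P n ω := by linarith
      simp only [hf, h, Set.indicator_of_mem]
      rw [abs_of_nonneg (by positivity)]
      gcongr
      exact div_le_self (by norm_num) (one_le_pow₀ h3)
    · simp only [hf, h, Set.indicator_of_notMem, not_false_eq_true, abs_zero]; positivity
  have hφi : Integrable φ P.μ := by
    refine bdd_ind_int P hS (X_meas P n hn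
      (fun x => ((n:ℝ)+1) * (1/x^2 + 8 * K^2/x^4) - 1/(6*K)^2))
      (C := ((n:ℝ)+1) * (1 + 8 * K^2) + 1) ?_
    intro ω h
    obtain ⟨h1, h2⟩ := S_X P hm1 hmn hb h
    have h3 : 1 ≤ X P n ω := by linarith
    have h4 : (0:ℝ) < X P n ω := by linarith
    have a1 : ((n:ℝ)+1) * (1/(X P n ω)^2 + 8 * K^2/(X P n ω)^4) ≤ ((n:ℝ)+1) * (1 + 8 * K^2) := by
      gcongr
      · exact div_le_self (by norm_num) (one_le_pow₀ h3)
      · exact div_le_self (by positivity) (one_le_pow₀ h3)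
    have a2 : 1 / (6*K)^2 ≤ 1 := div_le_self (by positivity) (one_le_pow₀ hb)
    have a3 : 0 ≤ ((n:ℝ)+1) * (1/(X P n ω)^2 + 8 * K^2/(X P n ω)^4) := by positivity
    have a4 : 0 ≤ 1 / (6*K)^2 := by positivity
    have a5 : 0 ≤ ((n:ℝ)+1) * (1 + 8 * K^2) := by positivity
    rw [abs_le]; constructor <;> linarith
  have hfd : Integrable (fun ω => f ω * (X P (n+1) ω - X P n ω)) P.μ :=
    (incr_int P n hn).bdd_mul (c := ((n:ℝ)+1)*2)
      (hfm.mono (P.F_le n) le_rfl).aestronglyMeasurable (Eventually.of_forall hfb)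
  have hfr : Integrable (fun ω => f ω * (X P n ω * rho α q n)) P.μ := by
    have h1 : Integrable (fun ω => X P n ω * rho α q n) P.μ :=
      integrable_condExp.congr (condExp_incr P n hn)
    exact h1.bdd_mul (c := ((n:ℝ)+1)*2)
      (hfm.mono (P.F_le n) le_rfl).aestronglyMeasurable (Eventually.of_forall hfb)
  calc ∫ ω, W P (6*K) m (n+1) ω ∂P.μ
      ≤ ∫ ω, (φ ω - f ω * (X P (n+1) ω - X P n ω)) ∂P.μ := by
        refine integral_mono (W_int P hm1 (by omega) hb) (hφi.sub hfd) ?_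
        intro ω
        by_cases h : ω ∈ S P (6*K) m n
        · obtain ⟨h1, h2⟩ := S_X P hm1 hmn hb h
          have hd := X_incr_abs P n hn ω
          rw [← hKd] at hd
          have hv := inv_sq_bound hK h1 hd
          have hxx : X P n ω + (X P (n+1) ω - X P n ω) = X P (n+1) ω := by ring
          rw [hxx] at hv
          simp only [hφ, hf, h, Set.indicator_of_mem]
          have hv2 : ((n:ℝ)+1) / (X P (n+1) ω)^2 - 1/(6*K)^2 ≤
              ((n:ℝ)+1) * (1/(X P n ω)^2 + 8 * K^2/(X P n ω)^4) - 1/(6*K)^2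
              - ((n:ℝ)+1) * (2/(X P n ω)^3) * (X P (n+1) ω - X P n ω) := by
            have := mul_le_mul_of_nonneg_left hv (by positivity : 0 ≤ (n:ℝ)+1)
            have e : ((n:ℝ)+1) / (X P (n+1) ω)^2 = ((n:ℝ)+1) * (1 / (X P (n+1) ω)^2) := by ring
            rw [e]; linarith
          refine le_trans ?_ hv2
          by_cases h' : ω ∈ S P (6*K) m (n+1)
          · simp [W, h']
          · simp only [W, h', Set.indicator_of_notMem, not_false_eq_true]
            have hle : X P (n+1) ω ≤ 6*K * Real.sqrt ((n+1 : ℕ) : ℝ) := by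
              by_contra hc
              push Not at hc
              apply h'
              refine ⟨h.1, fun k hk1 hk2 => ?_⟩
              rcases Nat.lt_or_ge n k with h3 | h3
              · obtain rfl : k = n+1 := by omega
                exact hc
              · exact h.2 k hk1 h3
            have hpos : 0 < X P (n+1) ω := by
              have := (abs_le.1 hd).1
              linarith
            have hsq : (X P (n+1) ω)^2 ≤ (6*K)^2 * ((n:ℝ)+1) := by
              have h5 := pow_le_pow_left₀ hpos.le hle 2
              rw [mul_pow, Real.sq_sqrt (by positivity)] at h5
              push_cast at h5
              exact h5
            rw [sub_nonneg, div_le_div_iff₀ (by positivity) (by positivity)]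
            linarith
        · have h' : ω ∉ S P (6*K) m (n+1) := fun hc =>
            h ⟨hc.1, fun k hk1 hk2 => hc.2 k hk1 (by omega)⟩
          simp [W, hφ, hf, h, h']
    _ = ∫ ω, (φ ω - f ω * (X P n ω * rho α q n)) ∂P.μ := by
        rw [integral_sub hφi hfd, integral_sub hφi hfr, pull_incr P n hn f hfm _ hfb]
    _ ≤ ∫ ω, W P (6*K) m n ω ∂P.μ := by
        refine integral_mono (hφi.sub hfr) (W_int P hm1 hmn hb) ?_
        intro ω
        by_cases h : ω ∈ S P (6*K) m n
        · obtain ⟨h1, h2⟩ := S_X P hm1 hmn hb h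
          simp only [W, hφ, hf, h, Set.indicator_of_mem]
          refine step_num hK (by exact_mod_cast hn) (by linarith) (by linarith)
            (rho_ge hα (by omega) hq0 hq)
        · simp [W, hφ, hf, h]

lemma S_prob (hα : -(1/3) ≤ α) (hq0 : 0 < q) (hq : q ≤ 1/100) {K : ℝ} (hKd : K = 1 + 2 * |α|)
    {m n : ℕ} (hm : 10 ≤ m) (hmn : m ≤ n) (hmb : 9 * (6*K)^2 < m) :
    P.μ.real (G P m) - 9 * (6*K)^2 / m ≤ P.μ.real (S P (6*K) m n) := by
  have := P.isProb
  have hK : 1 ≤ K := by rw [hKd]; linarith [abs_nonneg α]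
  have hb : 1 ≤ 6 * K := by linarith
  have hm1 : 1 ≤ m := by omega
  have hm0 : (0:ℝ) < m := by exact_mod_cast hm1
  have hmono : ∫ ω, W P (6*K) m n ω ∂P.μ ≤ ∫ ω, W P (6*K) m m ω ∂P.μ := by
    induction n, hmn using Nat.le_induction with
    | base => exact le_rfl
    | succ k hk ih => exact (W_step P hα hq0 hq hKd hm hk).trans ih
  have hZ := Z_pos hα hm1
  have hSG : S P (6*K) m m = G P m := by
    ext ω
    refine ⟨fun h => h.1, fun h => ⟨h, fun k h1 h2 => ?_⟩⟩
    obtain rfl : k = m := by omega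
    rw [G_X P hm1 le_rfl h]
    have h3 := Real.sq_sqrt hm0.le
    have h4 : 3 * (6*K) < Real.sqrt k := by
      apply Real.lt_sqrt_of_sq_lt; nlinarith
    have h5 : 0 < Real.sqrt k := Real.sqrt_pos.2 hm0
    calc 6*K * Real.sqrt k < (1/3 * Real.sqrt k) * Real.sqrt k := by
          apply mul_lt_mul_of_pos_right _ h5; linarith
      _ = 1/3 * k := by rw [mul_assoc, Real.mul_self_sqrt hm0.le]
      _ ≤ _ := by gcongr
  have hGm := P.F_le _ _ (G_meas P m)
  have hSm := P.F_le _ _ (S_meas P (6*K) m n hm1 hmn)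
  have up : ∫ ω, W P (6*K) m m ω ∂P.μ ≤ P.μ.real (G P m) * (9/m - 1/(6*K)^2) := by
    have : P.μ.real (G P m) * (9/m - 1/(6*K)^2) =
        ∫ ω, Set.indicator (G P m) (fun _ => (9/(m:ℝ) - 1/(6*K)^2)) ω ∂P.μ := by
      rw [integral_indicator_const _ hGm]; simp
    rw [this]
    refine integral_mono (W_int P hm1 le_rfl hb) ((integrable_const _).indicator hGm) ?_
    intro ω
    by_cases h : ω ∈ G P m
    · simp only [W, hSG, h, Set.indicator_of_mem]
      rw [G_X P hm1 le_rfl h]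
      gcongr ?_ - _
      rw [div_le_div_iff₀ (by positivity) hm0]
      have : 1/9 ≤ (Zse α m)^2 := by nlinarith
      nlinarith [mul_pos hm0 hm0]
    · simp [W, hSG, h]
  have lo : P.μ.real (S P (6*K) m n) * (-(1/(6*K)^2)) ≤ ∫ ω, W P (6*K) m n ω ∂P.μ := by
    have : P.μ.real (S P (6*K) m n) * (-(1/(6*K)^2)) =
        ∫ ω, Set.indicator (S P (6*K) m n) (fun _ => (-(1/(6*K)^2))) ω ∂P.μ := by
      rw [integral_indicator_const _ hSm]; simp
    rw [this]
    refine integral_mono ((integrable_const _).indicator hSm) (W_int P hm1 hmn hb) ?_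
    intro ω
    by_cases h : ω ∈ S P (6*K) m n
    · simp only [W, h, Set.indicator_of_mem]
      have : 0 ≤ (n:ℝ) / (X P n ω)^2 := by positivity
      linarith
    · simp [W, h]
  have fin := (lo.trans hmono).trans up
  have hB : (0:ℝ) < (6*K)^2 := by positivity
  have hg1 : P.μ.real (G P m) ≤ 1 := measureReal_le_one
  generalize (6*K)^2 = β at *
  have f2 := mul_le_mul_of_nonneg_left fin hB.le
  have e1 : β * (P.μ.real (S P (6*K) m n) * (-(1/β))) = - P.μ.real (S P (6*K) m n) := by
    field_simp
  have e2 : β * (P.μ.real (G P m) * (9/m - 1/β)) =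
      P.μ.real (G P m) * (9 * β / m) - P.μ.real (G P m) := by
    field_simp
  rw [e1, e2] at f2
  have : P.μ.real (G P m) * (9 * β / m) ≤ 1 * (9 * β / m) := by gcongr
  linarith

lemma S_sub (hα : -(1/3) ≤ α) {K : ℝ} (hKd : K = 1 + 2 * |α|) {A : ℝ} (hA : 0 < A)
    {m N : ℕ} (hm : 1 ≤ m) (hmN : m ≤ N) (hm1 : A^2 < m) (hm2 : (m:ℝ) - 1 ≤ A^2)
    {ω : Ω} (h : ω ∈ S P (6*K) m N) :
    tauHigh P A ω ≤ (N : ℕ∞) ∧ (N : ℕ∞) < tauLow P A 6 ω := by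
  have hge : (m : ℕ∞) ≤ tauHigh P A ω := by
    refine le_sInf ?_
    rintro _ ⟨n, rfl, hn, hlt⟩
    by_contra hc
    push Not at hc
    have hc' : n < m := by exact_mod_cast hc
    have hx := G_X P hn hc'.le h.1
    unfold X xf at hx
    rw [hx] at hlt
    have hn0 : (0:ℝ) < n := by exact_mod_cast hn
    have h1 : (n:ℝ) ≤ A^2 := by
      have : (n:ℝ) + 1 ≤ m := by exact_mod_cast hc'
      linarith
    have h2 : Real.sqrt n ≤ A := by
      rw [Real.sqrt_le_left hA.le]; exact h1
    have hZ := Z_pos hα hn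
    have h3 : Zse α n * n = Real.sqrt n * Zse α n * Real.sqrt n := by
      rw [mul_comm (Real.sqrt n), mul_assoc, Real.mul_self_sqrt hn0.le]
    rw [h3] at hlt
    have : Real.sqrt n * Zse α n * Real.sqrt n ≤ A * Zse α n * Real.sqrt n := by gcongr
    linarith
  have hle : tauHigh P A ω ≤ (m : ℕ∞) := by
    refine sInf_le ⟨m, rfl, hm, ?_⟩
    have hx := G_X P hm le_rfl h.1
    unfold X xf at hx
    rw [hx]
    have hn0 : (0:ℝ) < m := by exact_mod_cast hm
    have hZ := Z_pos hα hm
    have h2 : A < Real.sqrt m := Real.lt_sqrt_of_sq_lt hm1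
    have h3 : Zse α m * m = Real.sqrt m * Zse α m * Real.sqrt m := by
      rw [mul_comm (Real.sqrt m), mul_assoc, Real.mul_self_sqrt hn0.le]
    rw [h3]
    have h5 : 0 < Real.sqrt m := Real.sqrt_pos.2 hn0
    gcongr
  refine ⟨hle.trans (by exact_mod_cast hmN), ?_⟩
  have hlow : ((N + 1 : ℕ) : ℕ∞) ≤ tauLow P A 6 ω := by
    refine le_sInf ?_
    rintro _ ⟨n, rfl, hn, hx⟩
    by_contra hc
    push Not at hc
    have hc' : n < N + 1 := by exact_mod_cast hc
    have hmn : m < n := by exact_mod_cast hge.trans_lt hn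
    have h1 := h.2 n hmn.le (by omega)
    unfold X xf at h1
    have hZ := Z_le (α := α) (n := n) (by omega)
    rw [← hKd] at hZ
    have : 6 * Zse α n * Real.sqrt n ≤ 6 * K * Real.sqrt n := by gcongr
    linarith
  refine lt_of_lt_of_le ?_ hlow
  exact_mod_cast Nat.lt_succ_self N

end

end SEAux

/-- For shape exchangeable trees there are `B > 1` and `c_{α,2} > 0` such that for every
`q ∈ (0,1]`, with `A = q^(-1/4)`,
`liminf_N μ(τ_high(A) ≤ N, τ_low(B) > N) ≥ 1 - c_{α,2} √q`. -/
theorem se_good_event_bound (α : ℝ) (hα : α ∈ seAllowed) :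
    ∃ B c : ℝ, 1 < B ∧ 0 < c ∧
      ∀ q : ℝ, 0 < q → q ≤ 1 →
        ∀ (Ω : Type) [MeasurableSpace Ω] (P : SEProcess α q Ω),
          1 - c * Real.sqrt q ≤
            Filter.liminf (fun N : ℕ =>
              (P.μ {ω | tauHigh P (q ^ (-(1 : ℝ) / 4)) ω ≤ (N : ℕ∞) ∧
                (N : ℕ∞) < tauLow P (q ^ (-(1 : ℝ) / 4)) B ω}).toReal)
              Filter.atTop := by
  have hα3 : -(1/3) ≤ α := by
    rcases hα with ⟨d, hd, rfl⟩ | h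
    · have : (3:ℝ) ≤ d := by exact_mod_cast hd
      have h2 : 1/(d:ℝ) ≤ 1/3 := one_div_le_one_div_of_le (by norm_num) this
      have : -1/(d:ℝ) = -(1/d) := by ring
      linarith
    · have : (0:ℝ) ≤ α := h
      linarith
  obtain ⟨K, hKd⟩ : ∃ K : ℝ, K = 1 + 2 * |α| := ⟨_, rfl⟩
  have hK : 1 ≤ K := by rw [hKd]; linarith [abs_nonneg α]
  refine ⟨6, 1 + 9 * (6*K)^2, by norm_num, by positivity, ?_⟩
  intro q hq0 hq1 Ω _ P
  have := P.isProb
  have hcob : IsCoboundedUnder (· ≥ ·) atTop (fun N : ℕ =>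
      (P.μ {ω | tauHigh P (q ^ (-(1 : ℝ) / 4)) ω ≤ (N : ℕ∞) ∧
        (N : ℕ∞) < tauLow P (q ^ (-(1 : ℝ) / 4)) 6 ω}).toReal) := by
    apply IsBoundedUnder.isCoboundedUnder_ge
    exact isBoundedUnder_of ⟨1, fun N => measureReal_le_one⟩
  obtain ⟨r, hr⟩ : ∃ r, r = Real.sqrt q := ⟨_, rfl⟩
  have hr0 : 0 < r := by rw [hr]; exact Real.sqrt_pos.2 hq0
  have hrq : r^2 = q := by rw [hr]; exact Real.sq_sqrt hq0.le
  rw [← hr]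
  have hKK : 1 ≤ K^2 := one_le_pow₀ hK
  by_cases hbig : 1 ≤ 9 * (6*K)^2 * r
  · refine le_liminf_of_le hcob (Eventually.of_forall fun N => ?_)
    have h0 : 0 ≤ (P.μ {ω | tauHigh P (q ^ (-(1 : ℝ) / 4)) ω ≤ (N : ℕ∞) ∧
        (N : ℕ∞) < tauLow P (q ^ (-(1 : ℝ) / 4)) 6 ω}).toReal := ENNReal.toReal_nonneg
    refine le_trans ?_ h0
    nlinarith
  · push Not at hbig
    have hA0 : 0 < q ^ (-(1 : ℝ) / 4) := Real.rpow_pos_of_pos hq0 _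
    have hA2 : (q ^ (-(1 : ℝ) / 4))^2 = 1/r := by
      rw [← Real.rpow_natCast, ← Real.rpow_mul hq0.le, hr, Real.sqrt_eq_rpow, one_div,
        ← Real.rpow_neg hq0.le]
      norm_num
    generalize q ^ (-(1 : ℝ) / 4) = A at *
    obtain ⟨j, hj⟩ : ∃ j, j = ⌊1/r⌋₊ := ⟨_, rfl⟩
    have hj1 : (j:ℝ) ≤ 1/r := by rw [hj]; exact Nat.floor_le (by positivity)
    have hj2 : 1/r < (j:ℝ) + 1 := by rw [hj]; exact Nat.lt_floor_add_one _
    have hbr : 9 * (6*K)^2 < 1/r := by rw [lt_div_iff₀ hr0]; exact hbig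
    have hjr : (j:ℝ) * r ≤ 1 := by rwa [le_div_iff₀ hr0] at hj1
    have hr1 : r ≤ 1/100 := by nlinarith
    have hq2 : q ≤ 1/100 := by nlinarith
    have hm10 : 10 ≤ j + 1 := by
      have : (10:ℝ) ≤ j + 1 := by nlinarith
      exact_mod_cast this
    have hG := SEAux.G_prob P hα3 j
    have hG2 : 1 - r ≤ P.μ.real (SEAux.G P (j+1)) := by
      rw [hG]
      have := one_add_mul_le_pow (a := -q) (by linarith) j
      have e : 1 + -q = 1 - q := by ring
      rw [e] at this
      refine le_trans ?_ this
      have : (j:ℝ) * q ≤ r := by rw [← hrq]; nlinarith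
      linarith
    refine le_liminf_of_le hcob ?_
    filter_upwards [eventually_ge_atTop (j+1)] with N hN
    have hS := SEAux.S_prob P hα3 hq0 hq2 hKd hm10 hN (by push_cast; linarith)
    have hsub : SEAux.S P (6*K) (j+1) N ⊆ {ω | tauHigh P A ω ≤ (N : ℕ∞) ∧
        (N : ℕ∞) < tauLow P A 6 ω} := fun ω hω =>
      SEAux.S_sub P hα3 hKd hA0 (by omega) hN (by rw [hA2]; push_cast; exact hj2)
        (by rw [hA2]; push_cast; linarith) hω
    have hmono : P.μ.real (SEAux.S P (6*K) (j+1) N) ≤ (P.μ {ω | tauHigh P A ω ≤ (N : ℕ∞) ∧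
        (N : ℕ∞) < tauLow P A 6 ω}).toReal := measureReal_mono hsub
    refine le_trans ?_ hmono
    refine le_trans ?_ hS
    have h9 : 9 * (6*K)^2 / ((j+1 : ℕ) : ℝ) ≤ 9 * (6*K)^2 * r := by
      rw [div_le_iff₀ (by positivity)]
      push_cast
      rw [div_lt_iff₀ hr0] at hj2
      nlinarith [mul_pos (by positivity : 0 < 9 * (6*K)^2) hr0]
    linarith
end
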